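/- (Rule of integration by parts for partie-finie integrals.) Let F, G ∈ 𝓕 with integer exponents, assume ∂_iF and ∂_iG also admit singular expansions at y₁ and y₂, that FG = o(|x|^{−2}) at infinity with F∂_iG and G∂_iF integrable near infinity, and that Pf_{s₁,s₂} ∫ G ∂_iF d³x exists. Then Pf_{s₁,s₂} ∫ F ∂_iG d³x exists and Pf_{s₁,s₂} ∫ F ∂_iG d³x = − Pf_{s₁,s₂} ∫ G ∂_iF d³x − 4π (n₁ⁱ r₁² F G)₁ − 4π (n₂ⁱ r₂² F G)₂. -/

import Mathlib

open MeasureTheory Filter Topology Real Asymptotics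

noncomputable section

abbrev E3 : Type := EuclideanSpace ℝ (Fin 3)
abbrev S2 : Type := Metric.sphere (0 : E3) 1

/-- The surface measure `dΩ` on the unit sphere `S²` (total mass `4π`). -/
def dOmega : Measure S2 := (volume : Measure E3).toSphere

/-- A function on the unit sphere is smooth iff it is the restriction of
a smooth function on `ℝ³`. -/
def SmoothSphereFn (f : S2 → ℝ) : Prop :=
  ∃ g : E3 → ℝ, ContDiff ℝ (⊤ : ℕ∞) g ∧ ∀ n : S2, g (n : E3) = f n

/-- `F` admits a power-like singular expansion at `y` with coefficients `c`:
the family of exponents (the `a`'s with `c a ≠ 0`) is bounded below, with only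
finitely many exponents below any given bound, the coefficients are smooth
functions on the sphere, and for every `N`, `F(y + r n) = Σ_{a ≤ N} r^a (c a)(n)
+ o(r^N)` as `r → 0⁺`, uniformly in `n ∈ S²`. -/
structure HasSingExpansion (y : E3) (F : E3 → ℝ) (c : ℝ → S2 → ℝ) : Prop where
  smooth_coeffs : ∀ a : ℝ, SmoothSphereFn (c a)
  bddBelow : ∃ a₀ : ℝ, ∀ a : ℝ, a < a₀ → c a = 0
  finite_exponents : ∀ N : ℝ, {a : ℝ | a ≤ N ∧ c a ≠ 0}.Finite
  expansion : ∀ N : ℕ, ∀ ε > 0, ∃ δ > 0, ∀ r : ℝ, 0 < r → r < δ → ∀ n : S2,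
    |F (y + r • (n : E3)) - ∑ᶠ (a : ℝ) (_ : a ≤ (N : ℝ)), r ^ a * c a n| ≤ ε * r ^ (N : ℝ)

/-- The exponents of the singular expansion are integers. -/
def IntegerExponents (c : ℝ → S2 → ℝ) : Prop :=
  ∀ a : ℝ, c a ≠ 0 → ∃ k : ℤ, a = (k : ℝ)

/-- The Hadamard partie finie at the singular point, `(F)_y = (1/4π) ∫_{S²} f₀ dΩ`,
expressed in terms of the expansion coefficients `c` of `F`. -/
def pfAt (c : ℝ → S2 → ℝ) : ℝ :=
  (4 * π)⁻¹ * ∫ n : S2, c 0 n ∂dOmega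

/-- `F` is smooth on a punctured neighbourhood of `y`. -/
def SmoothNearPunctured (y : E3) (F : E3 → ℝ) : Prop :=
  ∃ U ∈ 𝓝 y, ContDiffOn ℝ (⊤ : ℕ∞) F (U \ {y})

/-- The quantity whose limit as `s → 0⁺` defines the Hadamard partie finie
`Pf_{s₁,s₂} ∫ F d³x`: the integral over `ℝ³` minus two balls of radius `s`,
plus the divergent subtractions built from the expansion coefficients `c` at `y₁`
and `d` at `y₂`. -/
def pfApprox (y₁ y₂ : E3) (s₁ s₂ : ℝ) (F : E3 → ℝ) (c d : ℝ → S2 → ℝ) (s : ℝ) : ℝ :=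
  (∫ x in (Metric.closedBall y₁ s ∪ Metric.closedBall y₂ s)ᶜ, F x)
    + (∑ᶠ (a : ℝ) (_ : a < -3), s ^ (a + 3) / (a + 3) * ∫ n : S2, c a n ∂dOmega)
    + Real.log (s / s₁) * (∫ n : S2, c (-3) n ∂dOmega)
    + (∑ᶠ (b : ℝ) (_ : b < -3), s ^ (b + 3) / (b + 3) * ∫ n : S2, d b n ∂dOmega)
    + Real.log (s / s₂) * (∫ n : S2, d (-3) n ∂dOmega)

/-- `Pf_{s₁,s₂} ∫ F d³x` exists and equals `L`. -/
def HasPfIntegral (y₁ y₂ : E3) (s₁ s₂ : ℝ) (F : E3 → ℝ) (c d : ℝ → S2 → ℝ) (L : ℝ) : Prop :=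
  Tendsto (pfApprox y₁ y₂ s₁ s₂ F c d) (𝓝[>] (0 : ℝ)) (𝓝 L)

/-- Membership in the class `𝓕`: smooth outside `{y₁, y₂}` and admitting singular
expansions at `y₁` (coefficients `c`) and `y₂` (coefficients `d`). -/
structure MemF (y₁ y₂ : E3) (F : E3 → ℝ) (c d : ℝ → S2 → ℝ) : Prop where
  smooth : ContDiffOn ℝ (⊤ : ℕ∞) F ({y₁, y₂}ᶜ : Set E3)
  exp₁ : HasSingExpansion y₁ F c
  exp₂ : HasSingExpansion y₂ F d

/-- The partial derivative `∂_i F` (as a plain function, defined outside the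
singularities via `fderiv`). -/
def pder (i : Fin 3) (F : E3 → ℝ) (x : E3) : ℝ :=
  fderiv ℝ F x (EuclideanSpace.single i 1)


instance instFiniteDOmega : IsFiniteMeasure dOmega := by
  unfold dOmega; infer_instance

theorem integral_polar {f : E3 → ℝ} (hf : Integrable f) :
    ∫ x, f x = ∫ r in Set.Ioi (0 : ℝ), r ^ 2 * ∫ n : S2, f (r • (n : E3)) ∂dOmega := by
  have hdim : Module.finrank ℝ E3 - 1 = 2 := by simp
  have hmp := (volume : Measure E3).measurePreserving_homeomorphUnitSphereProd
  rw [hdim] at hmp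
  have hemb := (homeomorphUnitSphereProd E3).measurableEmbedding
  let g : S2 × Set.Ioi (0 : ℝ) → ℝ := fun p => f ((p.2 : ℝ) • (p.1 : E3))
  have hg : ∀ x : ({0}ᶜ : Set E3), g (homeomorphUnitSphereProd E3 x) = f x := by
    intro x
    simp only [g]
    congr 1
    have := congrArg Subtype.val ((homeomorphUnitSphereProd E3).symm_apply_apply x)
    rw [homeomorphUnitSphereProd_symm_apply_coe] at this
    exact this
  have h1 : ∫ x, f x = ∫ x : ({(0)}ᶜ : Set E3), f x ∂((volume : Measure E3).comap (↑)) := by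
    rw [integral_subtype_comap (measurableSet_singleton _).compl f, restrict_compl_singleton]
  have h2 : ∫ x : ({(0)}ᶜ : Set E3), f x ∂((volume : Measure E3).comap (↑))
      = ∫ p, g p ∂(dOmega.prod (Measure.volumeIoiPow 2)) := by
    rw [dOmega, ← hmp.integral_comp hemb]
    simp only [hg]
  have hgi : Integrable g (dOmega.prod (Measure.volumeIoiPow 2)) := by
    rw [dOmega, ← hmp.integrable_comp_emb hemb]
    have : g ∘ (homeomorphUnitSphereProd E3) = fun x : ({(0)}ᶜ : Set E3) => f x := by
      ext x; exact hg x
    rw [this]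
    have := (integrableOn_iff_comap_subtypeVal (μ := (volume : Measure E3)) (f := f)
      (measurableSet_singleton (0 : E3)).compl).1 hf.integrableOn
    exact this
  rw [h1, h2, integral_prod_symm g hgi]
  simp only [Measure.volumeIoiPow, ENNReal.ofReal]
  rw [integral_withDensity_eq_integral_smul]
  · rw [integral_subtype_comap measurableSet_Ioi
      fun a ↦ Real.toNNReal (a ^ 2) • ∫ n : S2, f (a • (n : E3)) ∂dOmega]
    refine setIntegral_congr_fun measurableSet_Ioi fun x hx ↦ ?_
    simp only [NNReal.smul_def, smul_eq_mul]
    rw [Real.coe_toNNReal _ (sq_nonneg x)]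
  · exact (measurable_subtype_coe.pow_const _).real_toNNReal

theorem integral_polar_at (y : E3) {f : E3 → ℝ} (hf : Integrable f) :
    ∫ x, f x = ∫ r in Set.Ioi (0 : ℝ), r ^ 2 * ∫ n : S2, f (y + r • (n : E3)) ∂dOmega := by
  rw [← integral_polar (f := fun x => f (y + x)) (hf.comp_add_left y), integral_add_left_eq_self]

/-- spherical flux of `H` at radius `r` around `y`. -/
def fluxI (i : Fin 3) (y : E3) (H : E3 → ℝ) (r : ℝ) : ℝ :=
  r ^ 2 * ∫ n : S2, (n : E3) i * H (y + r • (n : E3)) ∂dOmega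

theorem continuousOn_sphInt (y : E3) {H : E3 → ℝ} {ρ : ℝ}
    (hH : ContinuousOn H (Metric.ball y ρ \ {y})) (g : S2 → ℝ) (hg : Continuous g) :
    ContinuousOn (fun r : ℝ => ∫ n : S2, g n * H (y + r • (n : E3)) ∂dOmega) (Set.Ioo 0 ρ) := by
  rw [continuousOn_iff_continuous_domRestrict]
  have hc : Continuous (fun q : (Set.Ioo (0:ℝ) ρ) × S2 => g q.2 * H (y + (q.1 : ℝ) • (q.2 : E3))) := by
    refine (hg.comp continuous_snd).mul ?_
    refine hH.comp_continuous (by fun_prop) ?_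
    rintro ⟨⟨r, h0, h1⟩, ⟨n, hn⟩⟩
    have hn' : ‖n‖ = 1 := by simpa using hn
    have hn0 : n ≠ 0 := by rintro rfl; simp at hn'
    simp [norm_smul, hn', abs_of_pos h0, h1, h0.ne', hn0]
  haveI : LocallyCompactSpace (Set.Ioo (0:ℝ) ρ) := isOpen_Ioo.isOpenEmbedding_subtypeVal.locallyCompactSpace
  have := continuous_parametric_integral_of_continuous (μ := dOmega) (f := fun (r : Set.Ioo (0:ℝ) ρ) (n : S2) => g n * H (y + (r : ℝ) • (n : E3)))
    hc (s := Set.univ) isCompact_univ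
  simpa [Set.domRestrict_def] using this

theorem continuousOn_fluxI (i : Fin 3) (y : E3) {H : E3 → ℝ} {ρ : ℝ}
    (hH : ContinuousOn H (Metric.ball y ρ \ {y})) :
    ContinuousOn (fluxI i y H) (Set.Ioo 0 ρ) := by
  unfold fluxI
  exact (continuousOn_id.pow 2).mul (continuousOn_sphInt y hH (fun n => (n : E3) i) (by fun_prop))

theorem hasFDerivAt_norm_E3 {x : E3} (hx : x ≠ 0) :
    HasFDerivAt (fun x : E3 => ‖x‖) (‖x‖⁻¹ • innerSL ℝ x) x := by
  have h := ((hasStrictFDerivAt_norm_sq x).hasFDerivAt).sqrt (by simpa using hx)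
  have e : (fun y : E3 => √(‖y‖ ^ 2)) = fun y => ‖y‖ := by
    ext y; exact Real.sqrt_sq (norm_nonneg y)
  rw [e] at h
  rw [Real.sqrt_sq (norm_nonneg x)] at h
  have e2 : ‖x‖⁻¹ • innerSL ℝ x = (1 / (2 * ‖x‖)) • 2 • (innerSL ℝ) x := by
    ext z
    have : ‖x‖ ≠ 0 := by simpa using hx
    simp
    field_simp
  rw [e2]
  exact h

/-- radial cutoff -/
def radCut (y : E3) (s k : ℝ) (x : E3) : ℝ := Real.smoothTransition (k * (‖x - y‖ - s))

theorem radCut_zero {y : E3} {s k : ℝ} (hk : 0 < k) {x : E3} (hx : ‖x - y‖ ≤ s) :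
    radCut y s k x = 0 :=
  Real.smoothTransition.zero_of_nonpos (mul_nonpos_of_nonneg_of_nonpos hk.le (by linarith))

theorem tsupport_radCut {y : E3} {s k : ℝ} (hk : 0 < k) :
    tsupport (radCut y s k) ⊆ {x | s ≤ ‖x - y‖} := by
  apply closure_minimal
  · intro x hx
    by_contra h
    exact hx (radCut_zero hk (not_le.1 h).le)
  · exact isClosed_le continuous_const (by fun_prop)

theorem contDiff_radCut {y : E3} {s k : ℝ} (hs : 0 < s) (hk : 0 < k) :
    ContDiff ℝ 1 (radCut y s k) := by
  rw [contDiff_iff_contDiffAt]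
  intro x
  by_cases hx : x = y
  · subst hx
    have : radCut x s k =ᶠ[𝓝 x] fun _ => 0 := by
      filter_upwards [Metric.ball_mem_nhds x hs] with z hz
      apply radCut_zero hk
      rw [Metric.mem_ball, dist_eq_norm] at hz
      exact hz.le
    exact contDiffAt_const.congr_of_eventuallyEq this
  · unfold radCut
    have h1 : ContDiffAt ℝ 1 (fun z : E3 => ‖z - y‖) x :=
      (contDiffAt_id.sub contDiffAt_const).norm ℝ (sub_ne_zero.2 hx)
    exact (Real.smoothTransition.contDiff (n := 1)).contDiffAt.comp x
      (contDiffAt_const.mul (h1.sub contDiffAt_const))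

theorem pder_radCut (i : Fin 3) {y : E3} {s k : ℝ} {x : E3} (hx : x ≠ y) :
    fderiv ℝ (radCut y s k) x (EuclideanSpace.single i 1) =
      k * deriv Real.smoothTransition (k * (‖x - y‖ - s)) * (‖x - y‖⁻¹ * (x - y) i) := by
  have h0 : HasFDerivAt (fun z : E3 => ‖z - y‖) (‖x - y‖⁻¹ • innerSL ℝ (x - y)) x := by
    have := (hasFDerivAt_norm_E3 (sub_ne_zero.2 hx)).comp x ((hasFDerivAt_id x).sub_const y)
    simpa using! this
  have h1 : HasFDerivAt (fun z : E3 => k * (‖z - y‖ - s))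
      (k • (‖x - y‖⁻¹ • innerSL ℝ (x - y))) x := (h0.sub_const s).const_mul k
  have h2 : HasDerivAt Real.smoothTransition (deriv Real.smoothTransition (k * (‖x - y‖ - s)))
      (k * (‖x - y‖ - s)) :=
    ((Real.smoothTransition.contDiff (n := 1)).differentiable (by simp)).differentiableAt.hasDerivAt
  have h3 := h2.comp_hasFDerivAt x h1
  have e : radCut y s k = Real.smoothTransition ∘ fun z : E3 => k * (‖z - y‖ - s) := rfl
  rw [e, h3.fderiv]
  simp [EuclideanSpace.inner_single_right]
  ring

theorem continuousOn_pder (i : Fin 3) {H : E3 → ℝ} {U : Set E3} (hU : IsOpen U)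
    (hH : ContDiffOn ℝ 1 H U) : ContinuousOn (pder i H) U := by
  have := hH.continuousOn_fderiv_of_isOpen hU le_rfl
  unfold pder
  exact this.clm_apply continuousOn_const

theorem integrableOn_compl_ball {y : E3} {f : E3 → ℝ} (hf : ContinuousOn f {y}ᶜ)
    (hc : HasCompactSupport f) {s : ℝ} (hs : 0 < s) : IntegrableOn f (Metric.ball y s)ᶜ := by
  have hK : IsCompact ((Metric.ball y s)ᶜ ∩ tsupport f) :=
    hc.isCompact.inter_left Metric.isOpen_ball.isClosed_compl
  have h1 : IntegrableOn f ((Metric.ball y s)ᶜ ∩ tsupport f) := by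
    refine ContinuousOn.integrableOn_compact hK (hf.mono ?_)
    rintro x ⟨hx, -⟩ rfl
    exact hx (Metric.mem_ball_self hs)
  refine h1.of_forall_sdiff_eq_zero Metric.isOpen_ball.measurableSet.compl ?_
  rintro x ⟨hx, hx'⟩
  apply image_eq_zero_of_notMem_tsupport
  exact fun h => hx' ⟨hx, h⟩

theorem continuous_cut_mul {y : E3} {f g : E3 → ℝ} {s : ℝ} (hs : 0 < s) (hf : ContinuousOn f {y}ᶜ)
    (hg : Continuous g) (hgs : tsupport g ⊆ {x | s ≤ ‖x - y‖}) : Continuous (fun x => g x * f x) := by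
  apply continuous_of_tsupport
  intro x hx
  have hx1 : x ∈ tsupport g := tsupport_mul_subset_left hx
  have hx2 : x ≠ y := by
    rintro rfl
    have := hgs hx1
    simp at this
    linarith
  exact hg.continuousAt.mul (hf.continuousAt (isOpen_compl_singleton.mem_nhds hx2))

theorem deriv_smoothTransition_zero {u : ℝ} (hu : u < 0 ∨ 1 < u) :
    deriv Real.smoothTransition u = 0 := by
  rcases hu with hu | hu
  · have : Real.smoothTransition =ᶠ[𝓝 u] fun _ => 0 := by
      filter_upwards [gt_mem_nhds hu] with z hz
      exact Real.smoothTransition.zero_of_nonpos hz.le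
    rw [this.deriv_eq]; simp
  · have : Real.smoothTransition =ᶠ[𝓝 u] fun _ => 1 := by
      filter_upwards [lt_mem_nhds hu] with z hz
      exact Real.smoothTransition.one_of_one_le hz.le
    rw [this.deriv_eq]; simp

theorem continuous_deriv_smoothTransition : Continuous (deriv Real.smoothTransition) :=
  (Real.smoothTransition.contDiff (n := 1)).continuous_deriv le_rfl

theorem div_one_step (i : Fin 3) {y : E3} {H : E3 → ℝ} (hH : ContDiffOn ℝ 1 H {y}ᶜ)
    (hc : HasCompactSupport H) {s k : ℝ} (hs : 0 < s) (hk : 0 < k) :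
    ∫ x, radCut y s k x * pder i H x
      = - ∫ u in (0:ℝ)..1, deriv Real.smoothTransition u * fluxI i y H (s + k⁻¹ * u) := by
  have hφ := contDiff_radCut (y := y) hs hk
  have hφ' : Continuous (fun x => fderiv ℝ (radCut y s k) x (EuclideanSpace.single i 1)) :=
    (hφ.continuous_fderiv (by simp)).clm_apply continuous_const
  have hts := tsupport_radCut (y := y) (s := s) hk
  have hts' : tsupport (fun x => fderiv ℝ (radCut y s k) x (EuclideanSpace.single i 1))
      ⊆ {x | s ≤ ‖x - y‖} := (tsupport_fderiv_apply_subset ℝ _).trans hts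
  have hI1 : Integrable (fun x => fderiv ℝ (radCut y s k) x (EuclideanSpace.single i 1) * H x) :=
    (continuous_cut_mul hs hH.continuousOn hφ' hts').integrable_of_hasCompactSupport hc.mul_left
  have hI2 : Integrable (fun x => radCut y s k x * fderiv ℝ H x (EuclideanSpace.single i 1)) :=
    (continuous_cut_mul hs (continuousOn_pder i isOpen_compl_singleton hH) hφ.continuous
      hts).integrable_of_hasCompactSupport (hc.fderiv_apply (𝕜 := ℝ) _).mul_left
  have hI3 : Integrable (fun x => radCut y s k x * H x) :=
    (continuous_cut_mul hs hH.continuousOn hφ.continuous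
      hts).integrable_of_hasCompactSupport hc.mul_left
  have key := integral_mul_fderiv_eq_neg_fderiv_mul_of_integrable hI1 hI2 hI3
    (fun x _ => (hφ.differentiable (by simp)) x) (by
      intro x hx
      have hx2 : x ≠ y := by
        rintro rfl
        have := hts hx
        simp at this
        linarith
      exact (hH.contDiffAt (isOpen_compl_singleton.mem_nhds hx2)).differentiableAt (by simp))
  unfold pder
  rw [key, integral_polar_at y hI1]
  congr 1
  have e1 : ∀ r ∈ Set.Ioi (0:ℝ), (r ^ 2 * ∫ n : S2, fderiv ℝ (radCut y s k) (y + r • (n : E3))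
      (EuclideanSpace.single i 1) * H (y + r • (n : E3)) ∂dOmega)
      = k * deriv Real.smoothTransition (k * (r - s)) * fluxI i y H r := by
    intro r hr
    have hr : 0 < r := hr
    have : ∀ n : S2, fderiv ℝ (radCut y s k) (y + r • (n : E3))
      (EuclideanSpace.single i 1) * H (y + r • (n : E3)) =
      k * deriv Real.smoothTransition (k * (r - s)) * ((n : E3) i * H (y + r • (n : E3))) := by
      rintro ⟨n, hn⟩
      have hn' : ‖n‖ = 1 := by simpa using hn
      have hn0 : n ≠ 0 := by rintro rfl; simp at hn'
      rw [pder_radCut i (by simp [hr.ne', hn0])]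
      simp only [add_sub_cancel_left, norm_smul, hn', Real.norm_eq_abs, abs_of_pos hr, mul_one,
        PiLp.smul_apply, smul_eq_mul]
      field_simp
    simp only [this, integral_const_mul, fluxI]
    ring
  rw [setIntegral_congr_fun measurableSet_Ioi e1]
  have e2 := intervalIntegral.smul_integral_comp_add_mul (a := 0) (b := 1)
    (fun r => k * deriv Real.smoothTransition (k * (r - s)) * fluxI i y H r) k⁻¹ s
  have e3 : ∀ u : ℝ, k * (s + k⁻¹ * u - s) = u := by intro u; field_simp; ring
  simp only [e3, mul_assoc, intervalIntegral.integral_const_mul, smul_eq_mul] at e2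
  rw [← mul_assoc, inv_mul_cancel₀ hk.ne', one_mul] at e2
  rw [e2, intervalIntegral.integral_of_le (by simp [hk.le])]
  simp only [mul_assoc, integral_const_mul]
  congr 1
  refine setIntegral_eq_of_subset_of_forall_sdiff_eq_zero (μ := (volume : Measure ℝ)) (t := Set.Ioi (0:ℝ)) measurableSet_Ioi ?_ ?_
  · intro r hr
    have := hr.1
    simp at this
    exact hs.trans this
  · rintro r ⟨hr, hr'⟩
    by_cases hrs : r = s
    · subst hrs
      have : deriv Real.smoothTransition 0 = 0 := by
        have h0 : IsLocalMin Real.smoothTransition 0 := by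
          filter_upwards with z
          rw [Real.smoothTransition.zero]
          exact Real.smoothTransition.nonneg z
        exact h0.deriv_eq_zero
      simp [this]
    rw [deriv_smoothTransition_zero]
    · simp
    · rcases lt_or_gt_of_ne hrs with h | h
      · left; exact mul_neg_of_pos_of_neg hk (by linarith)
      · right
        have : s + k⁻¹ < r := by
          by_contra h'
          exact hr' ⟨by simpa using h, by simpa using h'⟩
        have : k⁻¹ < r - s := by linarith
        calc (1:ℝ) = k * k⁻¹ := by field_simp
          _ < _ := by gcongr

theorem div_punctured (i : Fin 3) {y : E3} {H : E3 → ℝ} (hH : ContDiffOn ℝ 1 H {y}ᶜ)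
    (hc : HasCompactSupport H) {s : ℝ} (hs : 0 < s) :
    ∫ x in (Metric.closedBall y s)ᶜ, pder i H x = - fluxI i y H s := by
  have hcd : ContinuousOn (pder i H) {y}ᶜ := continuousOn_pder i isOpen_compl_singleton hH
  have hcs : HasCompactSupport (pder i H) := hc.fderiv_apply (𝕜 := ℝ) _
  have hk : ∀ k : ℕ, (0:ℝ) < (k:ℝ) + 1 := fun k => by positivity
  have T1 : Tendsto (fun k : ℕ => ∫ x, radCut y s ((k:ℝ)+1) x * pder i H x) atTop
      (𝓝 (∫ x, (Metric.closedBall y s)ᶜ.indicator (pder i H) x)) := by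
    refine tendsto_integral_of_dominated_convergence
      ((Metric.ball y s)ᶜ.indicator (fun x => ‖pder i H x‖)) ?_ ?_ ?_ ?_
    · intro k
      exact (continuous_cut_mul hs hcd (contDiff_radCut hs (hk k)).continuous
        (tsupport_radCut (hk k))).aestronglyMeasurable
    · rw [integrable_indicator_iff Metric.isOpen_ball.measurableSet.compl]
      exact (integrableOn_compl_ball hcd hcs hs).norm
    · intro k
      refine ae_of_all _ fun x => ?_
      by_cases hx : x ∈ Metric.ball y s
      · rw [radCut_zero (hk k)]
        · simp [hx]
        · rw [Metric.mem_ball, dist_eq_norm] at hx; exact hx.le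
      · rw [Set.indicator_of_mem (by simpa using hx), norm_mul]
        have : ‖radCut y s ((k:ℝ)+1) x‖ ≤ 1 := by
          rw [radCut, Real.norm_eq_abs, abs_of_nonneg (Real.smoothTransition.nonneg _)]
          exact Real.smoothTransition.le_one _
        exact mul_le_of_le_one_left (norm_nonneg _) this
    · refine ae_of_all _ fun x => ?_
      by_cases hx : x ∈ Metric.closedBall y s
      · have : ∀ k : ℕ, radCut y s ((k:ℝ)+1) x * pder i H x = 0 := by
          intro k
          rw [radCut_zero (hk k), zero_mul]
          rwa [Metric.mem_closedBall, dist_eq_norm] at hx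
        simp [this, hx]
      · rw [Set.indicator_of_mem (by simpa using hx)]
        rw [Metric.mem_closedBall, dist_eq_norm, not_le] at hx
        have ht : Tendsto (fun k : ℕ => ((k:ℝ)+1) * (‖x - y‖ - s)) atTop atTop :=
          (tendsto_atTop_add_const_right _ _ tendsto_natCast_atTop_atTop).atTop_mul_const
            (by linarith)
        apply tendsto_const_nhds.congr'
        filter_upwards [ht.eventually_ge_atTop 1] with k hk1
        rw [radCut, Real.smoothTransition.one_of_one_le hk1, one_mul]
  rw [integral_indicator Metric.isClosed_closedBall.measurableSet.compl] at T1
  have T2 : Tendsto (fun k : ℕ => ∫ x, radCut y s ((k:ℝ)+1) x * pder i H x) atTop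
      (𝓝 (- fluxI i y H s)) := by
    simp only [div_one_step i hH hc hs (hk _)]
    apply Tendsto.neg
    have hIc : ContinuousOn (fluxI i y H) (Set.Ioo 0 (s + 2)) := by
      apply continuousOn_fluxI
      exact hH.continuousOn.mono fun x hx => hx.2
    have hint1 : ∫ u in (0:ℝ)..1, deriv Real.smoothTransition u * fluxI i y H s = fluxI i y H s := by
      rw [intervalIntegral.integral_mul_const, intervalIntegral.integral_deriv_eq_sub]
      · simp
      · intro x _
        exact ((Real.smoothTransition.contDiff (n := 1)).differentiable (by simp)).differentiableAt
      · exact continuous_deriv_smoothTransition.intervalIntegrable _ _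
    rw [← hint1]
    obtain ⟨C, hC⟩ := (isCompact_Icc (a := s) (b := s + 1)).exists_bound_of_continuousOn
      (hIc.mono (fun r hr => ⟨hs.trans_le hr.1, by linarith [hr.2]⟩))
    have hmem : ∀ (k : ℕ) (u : ℝ), u ∈ Set.Icc (0:ℝ) 1 →
        s + ((k:ℝ)+1)⁻¹ * u ∈ Set.Icc s (s+1) := by
      intro k u hu
      have h1 : ((k:ℝ)+1)⁻¹ ≤ 1 := inv_le_one_of_one_le₀ (by linarith [(Nat.cast_nonneg k : (0:ℝ) ≤ k)])
      have h0 : 0 ≤ ((k:ℝ)+1)⁻¹ := by positivity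
      constructor
      · nlinarith [mul_nonneg h0 hu.1]
      · nlinarith [mul_le_one₀ h1 hu.1 hu.2]
    refine intervalIntegral.tendsto_integral_filter_of_dominated_convergence
      (fun u => ‖deriv Real.smoothTransition u‖ * C) ?_ ?_ ?_ ?_
    · refine Eventually.of_forall fun k => ?_
      refine ContinuousOn.aestronglyMeasurable ?_ measurableSet_uIoc
      refine continuous_deriv_smoothTransition.continuousOn.mul ?_
      refine hIc.comp (by fun_prop) ?_
      intro u hu
      rw [Set.uIoc_of_le zero_le_one] at hu
      have := hmem k u ⟨hu.1.le, hu.2⟩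
      exact ⟨hs.trans_le this.1, by linarith [this.2]⟩
    · refine Eventually.of_forall fun k => ae_of_all _ fun u hu => ?_
      rw [Set.uIoc_of_le zero_le_one] at hu
      rw [norm_mul]
      gcongr
      exact hC _ (hmem k u ⟨hu.1.le, hu.2⟩)
    · exact (continuous_deriv_smoothTransition.norm.mul_const C).intervalIntegrable _ _
    · refine ae_of_all _ fun u hu => ?_
      apply Tendsto.const_mul
      have hca : ContinuousAt (fluxI i y H) s :=
        hIc.continuousAt (isOpen_Ioo.mem_nhds ⟨hs, by linarith⟩)
      refine hca.tendsto.comp ?_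
      have : Tendsto (fun k : ℕ => s + ((k:ℝ)+1)⁻¹ * u) atTop (𝓝 (s + 0 * u)) := by
        apply Tendsto.const_add
        apply Tendsto.mul_const
        exact (tendsto_atTop_add_const_right _ _ tendsto_natCast_atTop_atTop).inv_tendsto_atTop
      simpa using this
  exact tendsto_nhds_unique T1 T2

theorem contDiffOn_cut {y : E3} {U : Set E3} (hU : IsOpen U) {H χ : E3 → ℝ}
    (hH : ContDiffOn ℝ 1 H (U \ {y})) (hχ : ContDiff ℝ 1 χ) (hs : tsupport χ ⊆ U) :
    ContDiffOn ℝ 1 (fun x => χ x * H x) {y}ᶜ := by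
  intro x hx
  apply ContDiffAt.contDiffWithinAt
  by_cases hxs : x ∈ tsupport χ
  · have : ContDiffAt ℝ 1 H x :=
      hH.contDiffAt ((hU.sdiff isClosed_singleton).mem_nhds ⟨hs hxs, hx⟩)
    exact hχ.contDiffAt.mul this
  · have : (fun x => χ x * H x) =ᶠ[𝓝 x] fun _ => 0 := by
      filter_upwards [(isClosed_tsupport χ).isOpen_compl.mem_nhds hxs] with z hz
      rw [image_eq_zero_of_notMem_tsupport hz, zero_mul]
    exact contDiffAt_const.congr_of_eventuallyEq this

theorem pder_congr {i : Fin 3} {f g : E3 → ℝ} {x : E3} (h : f =ᶠ[𝓝 x] g) :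
    pder i f x = pder i g x := by
  unfold pder; rw [h.fderiv_eq]

theorem fluxI_congr {i : Fin 3} {y : E3} {f g : E3 → ℝ} {s : ℝ} (hs : 0 < s)
    (h : ∀ x, dist x y = s → f x = g x) : fluxI i y f s = fluxI i y g s := by
  unfold fluxI
  congr 2
  ext n
  rw [h]
  have : ‖(n : E3)‖ = 1 := by simp
  simp [dist_eq_norm, norm_smul, abs_of_pos hs]

theorem annulus (i : Fin 3) {y : E3} {H : E3 → ℝ} {ρ : ℝ}
    (hH : ContDiffOn ℝ 1 H (Metric.ball y ρ \ {y})) {s t : ℝ} (hs : 0 < s) (hst : s ≤ t) (ht : t < ρ) :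
    fluxI i y H t - fluxI i y H s =
      ∫ r in s..t, r ^ 2 * ∫ n : S2, pder i H (y + r • (n : E3)) ∂dOmega := by
  have ht0 : 0 < t := hs.trans_le hst
  let χ : ContDiffBump y := ⟨(2 * t + ρ) / 3, (t + 2 * ρ) / 3, by linarith, by linarith⟩
  have hχs : tsupport χ ⊆ Metric.ball y ρ := by
    rw [χ.tsupport_eq]
    apply Metric.closedBall_subset_ball
    change (t + 2 * ρ) / 3 < ρ
    linarith
  let H1 : E3 → ℝ := fun x => χ x * H x
  have hH1 : ContDiffOn ℝ 1 H1 {y}ᶜ := contDiffOn_cut Metric.isOpen_ball hH χ.contDiff hχs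
  have hc1 : HasCompactSupport H1 := χ.hasCompactSupport.mul_right
  have hcd : ContinuousOn (pder i H1) {y}ᶜ := continuousOn_pder i isOpen_compl_singleton hH1
  have hcs : HasCompactSupport (pder i H1) := hc1.fderiv_apply (𝕜 := ℝ) _
  have heq : ∀ x ∈ Metric.ball y ((2 * t + ρ) / 3), H1 =ᶠ[𝓝 x] H := by
    intro x hx
    filter_upwards [χ.eventuallyEq_one_of_mem_ball hx] with z hz
    simp [H1, hz]
  have hf : ∀ r, 0 < r → r ≤ t → fluxI i y H1 r = fluxI i y H r := by
    intro r h0 hr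
    apply fluxI_congr h0
    intro x hx
    exact (heq x (by rw [Metric.mem_ball, hx]; linarith)).eq_of_nhds
  have hint : ∀ r, 0 < r → IntegrableOn (pder i H1) (Metric.closedBall y r)ᶜ := fun r hr =>
    (integrableOn_compl_ball hcd hcs hr).mono_set
      (Set.compl_subset_compl.2 Metric.ball_subset_closedBall)
  have h1 := div_punctured i hH1 hc1 hs
  have h2 := div_punctured i hH1 hc1 ht0
  rw [hf s hs hst] at h1
  rw [hf t ht0 le_rfl] at h2
  have hsub : (Metric.closedBall y t)ᶜ ⊆ (Metric.closedBall y s)ᶜ :=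
    Set.compl_subset_compl.2 (Metric.closedBall_subset_closedBall hst)
  have h3 := setIntegral_sdiff (μ := (volume : Measure E3)) (f := pder i H1)
    Metric.isClosed_closedBall.measurableSet.compl (hint s hs) hsub
  have h4 : fluxI i y H t - fluxI i y H s =
      ∫ x in (Metric.closedBall y s)ᶜ \ (Metric.closedBall y t)ᶜ, pder i H1 x := by linarith
  have hms : MeasurableSet ((Metric.closedBall y s)ᶜ \ (Metric.closedBall y t)ᶜ) :=
    Metric.isClosed_closedBall.measurableSet.compl.diff
      Metric.isClosed_closedBall.measurableSet.compl
  rw [h4, ← integral_indicator hms, integral_polar_at y, intervalIntegral.integral_of_le hst]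
  · rw [setIntegral_eq_of_subset_of_forall_sdiff_eq_zero (s := Set.Ioc s t) measurableSet_Ioi]
    · refine setIntegral_congr_fun measurableSet_Ioc fun r hr => ?_
      have hr0 : 0 < r := hs.trans hr.1
      congr 2
      ext n
      have hd : dist (y + r • (n : E3)) y = r := by
        simp [dist_eq_norm, norm_smul, abs_of_pos hr0]
      rw [Set.indicator_of_mem]
      · apply pder_congr
        apply heq
        rw [Metric.mem_ball, hd]
        linarith [hr.2]
      · simp only [Set.mem_sdiff, Set.mem_compl_iff, Metric.mem_closedBall, hd]
        simpa using hr
    · exact fun r hr => hs.trans hr.1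
    · rintro r ⟨hr0, hr⟩
      have hr0 : 0 < r := hr0
      have : ∀ n : S2, ((Metric.closedBall y s)ᶜ \ (Metric.closedBall y t)ᶜ).indicator (pder i H1)
          (y + r • (n : E3)) = 0 := by
        intro n
        have hd : dist (y + r • (n : E3)) y = r := by
          simp [dist_eq_norm, norm_smul, abs_of_pos hr0]
        apply Set.indicator_of_notMem
        simp only [Set.mem_sdiff, Set.mem_compl_iff, Metric.mem_closedBall, hd]
        simpa using hr
      simp only [this, integral_zero, mul_zero]
  · rw [integrable_indicator_iff hms]
    exact (hint s hs).mono_set Set.sdiff_subset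

theorem integral_pder_zero (i : Fin 3) {H : E3 → ℝ} (hH : ContDiff ℝ 1 H)
    (hi : Integrable (pder i H))
    (hd : Tendsto (fun x : E3 => ‖x‖ ^ 2 * H x) (cocompact E3) (𝓝 0)) :
    ∫ x, pder i H x = 0 := by
  let χ : ContDiffBump (0 : E3) := ⟨1, 2, by norm_num, by norm_num⟩
  let e : E3 := EuclideanSpace.single i 1
  have hχ1 : ContDiff ℝ 1 χ := χ.contDiff
  have hχd : Continuous (fun x => fderiv ℝ χ x e) :=
    (hχ1.continuous_fderiv (by simp)).clm_apply continuous_const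
  obtain ⟨C, hC⟩ := hχd.bounded_above_of_compact_support (χ.hasCompactSupport.fderiv_apply (𝕜 := ℝ) e)
  have hC0 : 0 ≤ C := (norm_nonneg _).trans (hC 0)
  let X : ℕ → E3 → ℝ := fun k x => χ (((k:ℝ)+1)⁻¹ • x)
  have hk : ∀ k : ℕ, (0:ℝ) < (k:ℝ) + 1 := fun k => by positivity
  have hXc : ∀ k, ContDiff ℝ 1 (X k) := fun k => hχ1.comp (contDiff_const_smul _)
  have hXs : ∀ k, HasCompactSupport (X k) := fun k =>
    χ.hasCompactSupport.comp_homeomorph (Homeomorph.smulOfNeZero _ (inv_ne_zero (hk k).ne'))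
  have hXd : ∀ k x, fderiv ℝ (X k) x e = ((k:ℝ)+1)⁻¹ * fderiv ℝ χ (((k:ℝ)+1)⁻¹ • x) e := by
    intro k x
    have h1 : HasFDerivAt (fun z : E3 => ((k:ℝ)+1)⁻¹ • z)
        (((k:ℝ)+1)⁻¹ • ContinuousLinearMap.id ℝ E3) x :=
      (((k:ℝ)+1)⁻¹ • ContinuousLinearMap.id ℝ E3).hasFDerivAt
    have h2 : HasFDerivAt χ (fderiv ℝ χ (((k:ℝ)+1)⁻¹ • x)) (((k:ℝ)+1)⁻¹ • x) :=
      ((hχ1.differentiable (by simp)) _).hasFDerivAt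
    have h3 := h2.comp x h1
    have e1 : X k = χ ∘ (fun z : E3 => ((k:ℝ)+1)⁻¹ • z) := rfl
    rw [e1, h3.fderiv]
    simp
  have hXdc : ∀ k, Continuous (fun x => fderiv ℝ (X k) x e) := fun k =>
    ((hXc k).continuous_fderiv (by simp)).clm_apply continuous_const
  have hHd : Continuous (fun x => fderiv ℝ H x e) :=
    (hH.continuous_fderiv (by simp)).clm_apply continuous_const
  have hI1 : ∀ k, Integrable (fun x => fderiv ℝ (X k) x e * H x) := fun k =>
    ((hXdc k).mul hH.continuous).integrable_of_hasCompactSupport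
      ((hXs k).fderiv_apply (𝕜 := ℝ) e).mul_right
  have key : ∀ k, ∫ x, X k x * pder i H x = - ∫ x, fderiv ℝ (X k) x e * H x := fun k =>
    integral_mul_fderiv_eq_neg_fderiv_mul_of_integrable
    (hI1 k)
    (((hXc k).continuous.mul hHd).integrable_of_hasCompactSupport (hXs k).mul_right)
    (((hXc k).continuous.mul hH.continuous).integrable_of_hasCompactSupport (hXs k).mul_right)
    (fun x _ => ((hXc k).differentiable (by simp)) x) (fun x _ => (hH.differentiable (by simp)) x)
  have T1 : Tendsto (fun k : ℕ => ∫ x, X k x * pder i H x) atTop (𝓝 (∫ x, pder i H x)) := by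
    refine tendsto_integral_of_dominated_convergence (fun x => ‖pder i H x‖) ?_ hi.norm ?_ ?_
    · intro k
      exact ((hXc k).continuous.mul hHd).aestronglyMeasurable
    · intro k
      refine ae_of_all _ fun x => ?_
      rw [norm_mul]
      refine mul_le_of_le_one_left (norm_nonneg _) ?_
      rw [Real.norm_eq_abs, abs_of_nonneg χ.nonneg]
      exact χ.le_one
    · refine ae_of_all _ fun x => ?_
      have : Tendsto (fun k : ℕ => ((k:ℝ)+1)⁻¹ • x) atTop (𝓝 ((0:ℝ) • x)) :=
        ((tendsto_atTop_add_const_right _ _ tendsto_natCast_atTop_atTop).inv_tendsto_atTop).smul_const x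
      rw [zero_smul] at this
      have h2 := (χ.continuous.tendsto 0).comp this
      rw [χ.one_of_mem_closedBall (by simp [χ])] at h2
      simpa using! h2.mul_const (pder i H x)
  have T2 : Tendsto (fun k : ℕ => ∫ x, fderiv ℝ (X k) x e * H x) atTop (𝓝 0) := by
    rw [Metric.tendsto_atTop]
    intro ε hε
    let V : ℝ := volume.real (Metric.closedBall (0 : E3) 1)
    have hV : 0 ≤ V := measureReal_nonneg
    obtain ⟨η, hη, hηε⟩ : ∃ η > 0, C * η * (8 * V) < ε := by
      refine ⟨ε / (C * (8 * V) + 1), by positivity, ?_⟩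
      have h8 : 0 ≤ C * (8 * V) := by positivity
      have : C * (ε / (C * (8 * V) + 1)) * (8 * V) = ε * ((C * (8 * V)) / (C * (8 * V) + 1)) := by
        ring
      rw [this]
      refine mul_lt_of_lt_one_right hε ?_
      rw [div_lt_one (by positivity)]
      linarith
    rw [Metric.tendsto_nhds] at hd
    have hd' := hd η hη
    rw [← Metric.cobounded_eq_cocompact, (Metric.hasBasis_cobounded_compl_closedBall (0:E3)).eventually_iff] at hd'
    obtain ⟨R, -, hR⟩ := hd'
    obtain ⟨K, hK⟩ := exists_nat_gt R
    refine ⟨K, fun k hkK => ?_⟩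
    have hKk : (K:ℝ) ≤ k := by exact_mod_cast hkK
    set m : ℝ := (k:ℝ) + 1 with hm
    have hm0 : 0 < m := hk k
    have hpt : ∀ x, ‖fderiv ℝ (X k) x e * H x‖ ≤
        (Metric.closedBall (0:E3) (2 * m)).indicator (fun _ => m⁻¹ * C * (η * (m^2)⁻¹)) x := by
      intro x
      by_cases hx2 : x ∈ Metric.closedBall (0:E3) (2 * m)
      · rw [Set.indicator_of_mem hx2, hXd, norm_mul, norm_mul, Real.norm_of_nonneg (inv_nonneg.2 hm0.le)]
        by_cases hx1 : ‖x‖ < m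
        · have : fderiv ℝ χ (m⁻¹ • x) e = 0 := by
            have : (χ : E3 → ℝ) =ᶠ[𝓝 (m⁻¹ • x)] fun _ => 1 := by
              apply χ.eventuallyEq_one_of_mem_ball
              simp only [Metric.mem_ball, dist_zero_right, norm_smul, norm_inv, Real.norm_of_nonneg hm0.le]
              change m⁻¹ * ‖x‖ < 1
              rw [inv_mul_lt_iff₀ hm0]; linarith
            rw [this.fderiv_eq]; simp
          rw [this]
          simp
          positivity
        · rw [not_lt] at hx1
          have hH' : ‖H x‖ ≤ η * (m^2)⁻¹ := by
            have hxR : x ∈ (Metric.closedBall (0:E3) R)ᶜ := by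
              simp only [Set.mem_compl_iff, Metric.mem_closedBall, dist_zero_right, not_le]
              linarith
            have := hR hxR
            rw [dist_zero_right, norm_mul, norm_pow, norm_norm] at this
            rw [← div_eq_mul_inv, le_div_iff₀ (by positivity)]
            calc ‖H x‖ * m^2 ≤ ‖H x‖ * ‖x‖^2 := by gcongr
              _ ≤ η := by linarith
          gcongr
          exact hC _
      · rw [Set.indicator_of_notMem hx2, hXd]
        have : fderiv ℝ χ (m⁻¹ • x) e = 0 := by
          have : m⁻¹ • x ∉ tsupport (χ : E3 → ℝ) := by
            rw [χ.tsupport_eq]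
            simp only [Metric.mem_closedBall, dist_zero_right, norm_smul, norm_inv, Real.norm_of_nonneg hm0.le] at hx2 ⊢
            change ¬ (m⁻¹ * ‖x‖ ≤ 2)
            rw [inv_mul_le_iff₀ hm0]; linarith
          have h := fun h => this (tsupport_fderiv_subset ℝ h)
          rw [image_eq_zero_of_notMem_tsupport h]; simp
        rw [this]; simp
    rw [dist_zero_right]
    have hvol : volume.real (Metric.closedBall (0:E3) (2*m)) = (2 * m)^3 * V := by
      rw [measureReal_def, Measure.addHaar_closedBall' _ _ (by positivity), ENNReal.toReal_mul,
        ENNReal.toReal_ofReal (by positivity)]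
      simp [V, measureReal_def]
    calc ‖∫ x, fderiv ℝ (X k) x e * H x‖
        ≤ ∫ x, (Metric.closedBall (0:E3) (2 * m)).indicator (fun _ => m⁻¹ * C * (η * (m^2)⁻¹)) x := by
          refine norm_integral_le_of_norm_le ?_ (ae_of_all _ hpt)
          rw [integrable_indicator_iff Metric.isClosed_closedBall.measurableSet]
          exact integrableOn_const (measure_closedBall_lt_top.ne)
      _ = C * η * (8 * V) := by
          rw [integral_indicator Metric.isClosed_closedBall.measurableSet, setIntegral_const, hvol, smul_eq_mul]
          field_simp
          ring
      _ < ε := hηε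
  have T3 : Tendsto (fun k : ℕ => ∫ x, X k x * pder i H x) atTop (𝓝 0) := by
    simp only [key]
    simpa using T2.neg
  exact tendsto_nhds_unique T1 T3

theorem div_global (i : Fin 3) {y₁ y₂ : E3} {H : E3 → ℝ} (hH : ContDiffOn ℝ 1 H {y₁, y₂}ᶜ)
    {s : ℝ} (hs : 0 < s) (hsy : 6 * s < dist y₁ y₂)
    (hint : IntegrableOn (pder i H) (Metric.closedBall y₁ s ∪ Metric.closedBall y₂ s)ᶜ)
    (hd : Tendsto (fun x : E3 => ‖x‖ ^ 2 * H x) (cocompact E3) (𝓝 0)) :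
    ∫ x in (Metric.closedBall y₁ s ∪ Metric.closedBall y₂ s)ᶜ, pder i H x =
      - fluxI i y₁ H s - fluxI i y₂ H s := by
  let χ₁ : ContDiffBump y₁ := ⟨2 * s, 3 * s, by linarith, by linarith⟩
  let χ₂ : ContDiffBump y₂ := ⟨2 * s, 3 * s, by linarith, by linarith⟩
  have hts₁ : tsupport χ₁ = Metric.closedBall y₁ (3 * s) := χ₁.tsupport_eq
  have hts₂ : tsupport χ₂ = Metric.closedBall y₂ (3 * s) := χ₂.tsupport_eq
  have hone₁ : ∀ x ∈ Metric.ball y₁ (2 * s), χ₁ =ᶠ[𝓝 x] 1 := fun x hx =>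
    χ₁.eventuallyEq_one_of_mem_ball hx
  have hone₂ : ∀ x ∈ Metric.ball y₂ (2 * s), χ₂ =ᶠ[𝓝 x] 1 := fun x hx =>
    χ₂.eventuallyEq_one_of_mem_ball hx
  have hzero₁ : ∀ x, 3 * s < dist x y₁ → χ₁ =ᶠ[𝓝 x] 0 := by
    intro x hx
    rw [← notMem_tsupport_iff_eventuallyEq, hts₁]
    simpa using hx
  have hzero₂ : ∀ x, 3 * s < dist x y₂ → χ₂ =ᶠ[𝓝 x] 0 := by
    intro x hx
    rw [← notMem_tsupport_iff_eventuallyEq, hts₂]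
    simpa using hx
  have hfar₁ : ∀ x, dist x y₂ ≤ 2 * s → 3 * s < dist x y₁ := by
    intro x hx
    have := dist_triangle_left y₁ y₂ x
    linarith
  have hfar₂ : ∀ x, dist x y₁ ≤ 2 * s → 3 * s < dist x y₂ := by
    intro x hx
    have := dist_triangle_left y₁ y₂ x
    linarith
  have hset₁ : ({y₂}ᶜ : Set E3) \ {y₁} = {y₁, y₂}ᶜ := by ext; simp [and_comm]
  have hset₂ : ({y₁}ᶜ : Set E3) \ {y₂} = {y₁, y₂}ᶜ := by ext; simp
  have hH1 : ContDiffOn ℝ 1 (fun x => χ₁ x * H x) {y₁}ᶜ := by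
    apply contDiffOn_cut isOpen_compl_singleton (hset₁ ▸ hH) χ₁.contDiff
    rw [hts₁]
    rintro x hx rfl
    rw [Metric.mem_closedBall] at hx
    have := hfar₁ x (by simp; linarith)
    linarith
  have hH2 : ContDiffOn ℝ 1 (fun x => χ₂ x * H x) {y₂}ᶜ := by
    apply contDiffOn_cut isOpen_compl_singleton (hset₂ ▸ hH) χ₂.contDiff
    rw [hts₂]
    rintro x hx rfl
    rw [Metric.mem_closedBall] at hx
    have := hfar₂ x (by simp; linarith)
    linarith
  have hc1 : HasCompactSupport (fun x => χ₁ x * H x) := χ₁.hasCompactSupport.mul_right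
  have hc2 : HasCompactSupport (fun x => χ₂ x * H x) := χ₂.hasCompactSupport.mul_right
  let H3 : E3 → ℝ := fun x => (1 - χ₁ x - χ₂ x) * H x
  have hz3₁ : ∀ x, dist x y₁ < 2 * s → H3 =ᶠ[𝓝 x] fun _ => 0 := by
    intro x hx
    filter_upwards [hone₁ x hx, hzero₂ x (hfar₂ x hx.le)] with z h1 h2
    simp [H3, h1, h2]
  have hz3₂ : ∀ x, dist x y₂ < 2 * s → H3 =ᶠ[𝓝 x] fun _ => 0 := by
    intro x hx
    filter_upwards [hone₂ x hx, hzero₁ x (hfar₁ x hx.le)] with z h1 h2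
    simp [H3, h1, h2]
  have hχ₁ : ContDiff ℝ 1 χ₁ := χ₁.contDiff
  have hχ₂ : ContDiff ℝ 1 χ₂ := χ₂.contDiff
  have hopen : IsOpen ({y₁, y₂}ᶜ : Set E3) := (Set.toFinite _).isClosed.isOpen_compl
  have hH3 : ContDiff ℝ 1 H3 := by
    rw [contDiff_iff_contDiffAt]
    intro x
    by_cases h1 : x = y₁
    · subst h1
      exact contDiffAt_const.congr_of_eventuallyEq (hz3₁ x (by simp; linarith))
    by_cases h2 : x = y₂
    · subst h2
      exact contDiffAt_const.congr_of_eventuallyEq (hz3₂ x (by simp; linarith))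
    exact ((contDiffAt_const.sub hχ₁.contDiffAt).sub hχ₂.contDiffAt).mul
      (hH.contDiffAt (hopen.mem_nhds (by simp [h1, h2])))
  have hp3₁ : ∀ x, dist x y₁ < 2 * s → pder i H3 x = 0 := by
    intro x hx
    rw [pder_congr (hz3₁ x hx)]; simp [pder]
  have hp3₂ : ∀ x, dist x y₂ < 2 * s → pder i H3 x = 0 := by
    intro x hx
    rw [pder_congr (hz3₂ x hx)]; simp [pder]
  have hp1 : ∀ x, 3 * s < dist x y₁ → pder i (fun x => χ₁ x * H x) x = 0 := by
    intro x hx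
    have : (fun x => χ₁ x * H x) =ᶠ[𝓝 x] fun _ => 0 := by
      filter_upwards [hzero₁ x hx] with z hz
      simp [hz]
    rw [pder_congr this]; simp [pder]
  have hp2 : ∀ x, 3 * s < dist x y₂ → pder i (fun x => χ₂ x * H x) x = 0 := by
    intro x hx
    have : (fun x => χ₂ x * H x) =ᶠ[𝓝 x] fun _ => 0 := by
      filter_upwards [hzero₂ x hx] with z hz
      simp [hz]
    rw [pder_congr this]; simp [pder]
  set O : Set E3 := (Metric.closedBall y₁ s ∪ Metric.closedBall y₂ s)ᶜ with hO
  have hOm : MeasurableSet O :=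
    (Metric.isClosed_closedBall.union Metric.isClosed_closedBall).measurableSet.compl
  have hOne : ∀ x ∈ O, x ≠ y₁ ∧ x ≠ y₂ := by
    intro x hx
    simp only [hO, Set.mem_compl_iff, Set.mem_union, Metric.mem_closedBall, not_or, not_le] at hx
    constructor
    · rintro rfl; simp at hx; linarith
    · rintro rfl; simp at hx; linarith
  have hO1 : O ⊆ (Metric.closedBall y₁ s)ᶜ := Set.compl_subset_compl.2 Set.subset_union_left
  have hO2 : O ⊆ (Metric.closedBall y₂ s)ᶜ := Set.compl_subset_compl.2 Set.subset_union_right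
  have hsum : ∀ x ∈ O, pder i H x = pder i (fun x => χ₁ x * H x) x
      + pder i (fun x => χ₂ x * H x) x + pder i H3 x := by
    intro x hx
    obtain ⟨h1, h2⟩ := hOne x hx
    have d1 : DifferentiableAt ℝ (fun x => χ₁ x * H x) x :=
      (hH1.contDiffAt (isOpen_compl_singleton.mem_nhds h1)).differentiableAt (by simp)
    have d2 : DifferentiableAt ℝ (fun x => χ₂ x * H x) x :=
      (hH2.contDiffAt (isOpen_compl_singleton.mem_nhds h2)).differentiableAt (by simp)
    have d3 : DifferentiableAt ℝ H3 x := (hH3.differentiable (by simp)) x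
    have e : H = fun x => (χ₁ x * H x + χ₂ x * H x) + H3 x := by
      ext z; simp only [H3]; ring
    conv_lhs => rw [e]
    unfold pder
    rw [fderiv_fun_add (d1.fun_add d2) d3, fderiv_fun_add d1 d2]
    rfl
  have i1' : IntegrableOn (pder i (fun x => χ₁ x * H x)) (Metric.closedBall y₁ s)ᶜ :=
    (integrableOn_compl_ball (continuousOn_pder i isOpen_compl_singleton hH1)
      (hc1.fderiv_apply (𝕜 := ℝ) _) hs).mono_set
      (Set.compl_subset_compl.2 Metric.ball_subset_closedBall)
  have i2' : IntegrableOn (pder i (fun x => χ₂ x * H x)) (Metric.closedBall y₂ s)ᶜ :=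
    (integrableOn_compl_ball (continuousOn_pder i isOpen_compl_singleton hH2)
      (hc2.fderiv_apply (𝕜 := ℝ) _) hs).mono_set
      (Set.compl_subset_compl.2 Metric.ball_subset_closedBall)
  have i1 := i1'.mono_set hO1
  have i2 := i2'.mono_set hO2
  have i3 : IntegrableOn (pder i H3) O := by
    refine ((hint.sub i1).sub i2).congr_fun ?_ hOm
    intro x hx
    simp only [Pi.sub_apply]
    rw [hsum x hx]; ring
  have hz3O : ∀ x, x ∉ O → pder i H3 x = 0 := by
    intro x hx
    simp only [hO, Set.mem_compl_iff, not_not, Set.mem_union, Metric.mem_closedBall] at hx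
    rcases hx with h | h
    · exact hp3₁ x (by linarith)
    · exact hp3₂ x (by linarith)
  have i3' : Integrable (pder i H3) := by
    rw [← integrableOn_univ]
    exact i3.of_forall_sdiff_eq_zero MeasurableSet.univ fun x hx => hz3O x hx.2
  have hd3 : Tendsto (fun x : E3 => ‖x‖ ^ 2 * H3 x) (cocompact E3) (𝓝 0) := by
    refine hd.congr' ?_
    have hK : IsCompact (tsupport χ₁ ∪ tsupport χ₂) :=
      χ₁.hasCompactSupport.isCompact.union χ₂.hasCompactSupport.isCompact
    filter_upwards [hK.compl_mem_cocompact] with x hx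
    simp only [Set.mem_compl_iff, Set.mem_union, not_or] at hx
    simp [H3, image_eq_zero_of_notMem_tsupport hx.1, image_eq_zero_of_notMem_tsupport hx.2]
  have r3 : ∫ x in O, pder i H3 x = 0 := by
    rw [setIntegral_eq_integral_of_forall_compl_eq_zero hz3O]
    exact integral_pder_zero i hH3 i3' hd3
  have r1 : ∫ x in O, pder i (fun x => χ₁ x * H x) x = - fluxI i y₁ H s := by
    rw [← setIntegral_eq_of_subset_of_forall_sdiff_eq_zero (t := (Metric.closedBall y₁ s)ᶜ)
      Metric.isClosed_closedBall.measurableSet.compl hO1, div_punctured i hH1 hc1 hs]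
    · congr 1
      apply fluxI_congr hs
      intro x hx
      rw [(hone₁ x (by rw [Metric.mem_ball]; linarith)).eq_of_nhds]; simp
    · rintro x ⟨hx, hx'⟩
      simp only [hO, Set.mem_compl_iff, not_not, Set.mem_union, Metric.mem_closedBall] at hx hx'
      have := hx'.resolve_left hx
      exact hp1 x (hfar₁ x (by linarith))
  have r2 : ∫ x in O, pder i (fun x => χ₂ x * H x) x = - fluxI i y₂ H s := by
    rw [← setIntegral_eq_of_subset_of_forall_sdiff_eq_zero (t := (Metric.closedBall y₂ s)ᶜ)
      Metric.isClosed_closedBall.measurableSet.compl hO2, div_punctured i hH2 hc2 hs]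
    · congr 1
      apply fluxI_congr hs
      intro x hx
      rw [(hone₂ x (by rw [Metric.mem_ball]; linarith)).eq_of_nhds]; simp
    · rintro x ⟨hx, hx'⟩
      simp only [hO, Set.mem_compl_iff, not_not, Set.mem_union, Metric.mem_closedBall] at hx hx'
      have := hx'.resolve_right hx
      exact hp2 x (hfar₂ x (by linarith))
  have i12 : IntegrableOn (fun x => pder i (fun x => χ₁ x * H x) x
      + pder i (fun x => χ₂ x * H x) x) O := i1.add i2
  rw [setIntegral_congr_fun hOm hsum, integral_add i12 i3, integral_add i1 i2, r1, r2, r3]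
  ring

lemma SmoothSphereFn.cont {f : S2 → ℝ} (h : SmoothSphereFn f) : Continuous f := by
  obtain ⟨g, hg, h⟩ := h
  have : f = fun n : S2 => g (n : E3) := funext fun n => (h n).symm
  rw [this]
  exact hg.continuous.comp continuous_subtype_val

lemma integrable_sph {f : S2 → ℝ} (h : Continuous f) : Integrable f dOmega :=
  (h.integrable_of_hasCompactSupport (HasCompactSupport.of_compactSpace f))

lemma finsum_eq_sum_T {c : ℝ → ℝ} {P : ℝ → Prop} {T : Finset ℝ}
    (hTP : ∀ a ∈ T, P a) (hT : ∀ a, P a → c a ≠ 0 → a ∈ T) :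
    ∑ᶠ (a : ℝ) (_ : P a), c a = ∑ a ∈ T, c a := by
  have : (fun a => ∑ᶠ (_ : P a), c a) = fun a => ∑ᶠ (_ : a ∈ T), c a := by
    funext a
    by_cases hP : P a
    · by_cases hc : c a = 0
      · simp [hc]
      · simp [hP, hT a hP hc]
    · have : a ∉ T := fun h => hP (hTP a h)
      simp [hP, this]
  rw [finsum_congr (fun a => congrFun this a), finsum_mem_finset_eq_sum]

lemma sing_int {y : E3} {F : E3 → ℝ} {c : ℝ → S2 → ℝ} {ρ : ℝ} (hρ : 0 < ρ)
    (h : HasSingExpansion y F c) (g : S2 → ℝ) (hg : Continuous g)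
    (hF : ContinuousOn F (Metric.ball y ρ \ {y})) (T : Finset ℝ)
    (hT0 : ∀ a ∈ T, a ≤ 0) (hT : ∀ a, a ≤ 0 → c a ≠ 0 → a ∈ T) :
    Tendsto (fun r : ℝ => (∫ n : S2, g n * F (y + r • (n : E3)) ∂dOmega)
      - ∑ a ∈ T, r ^ a * ∫ n : S2, g n * c a n ∂dOmega) (𝓝[>] (0 : ℝ)) (𝓝 0) := by
  have := instFiniteDOmega
  obtain ⟨M, hM⟩ := (isCompact_range hg).isBounded.exists_norm_le
  have hM : ∀ n, |g n| ≤ M := fun n => hM _ ⟨n, rfl⟩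
  set K : ℝ := |M| * (dOmega Set.univ).toReal + 1 with hK
  have hKpos : 0 < K := by positivity
  rw [Metric.tendsto_nhdsWithin_nhds]
  intro ε hε
  obtain ⟨δ, hδ, hexp⟩ := h.expansion 0 (ε / (2 * K)) (by positivity)
  refine ⟨min δ ρ, lt_min hδ hρ, fun {r} hr hrd => ?_⟩
  have hr : 0 < r := hr
  rw [Real.dist_eq, sub_zero, abs_of_pos hr] at hrd
  have hrδ := hrd.trans_le (min_le_left _ _)
  have hrρ := hrd.trans_le (min_le_right _ _)
  have hFc : Continuous fun n : S2 => F (y + r • (n : E3)) := by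
    refine hF.comp_continuous (by fun_prop) fun n => ?_
    have hn : ‖(n : E3)‖ = 1 := by simpa using n.2
    refine ⟨?_, ?_⟩
    · rw [Metric.mem_ball, dist_eq_norm]
      simp [norm_smul, abs_of_pos hr, hn, hrρ]
    · intro h0
      have h0 : y + r • (n : E3) = y := h0
      rw [add_eq_left] at h0
      have := congrArg norm h0
      simp [norm_smul, hn, hr.ne'] at this
  have hcc : ∀ a, Continuous (c a) := fun a => (h.smooth_coeffs a).cont
  have e1 : ∑ a ∈ T, r ^ a * ∫ n : S2, g n * c a n ∂dOmega
      = ∫ n : S2, g n * ∑ a ∈ T, r ^ a * c a n ∂dOmega := by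
    simp_rw [Finset.mul_sum]
    rw [integral_finsetSum]
    · refine Finset.sum_congr rfl fun a _ => ?_
      rw [← integral_const_mul]
      refine integral_congr_ae (Eventually.of_forall fun n => ?_)
      simp only; ring
    · intro a _
      exact integrable_sph (hg.mul (continuous_const.mul (hcc a)))
  have j1 : Integrable (fun n : S2 => g n * F (y + r • (n : E3))) dOmega :=
    integrable_sph (hg.mul hFc)
  have j2 : Integrable (fun n : S2 => g n * ∑ a ∈ T, r ^ a * c a n) dOmega :=
    integrable_sph (hg.mul (continuous_finsetSum _ fun a _ => continuous_const.mul (hcc a)))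
  rw [Real.dist_eq, sub_zero, e1, ← integral_sub j1 j2]
  have hb : ∀ n : S2, ‖g n * F (y + r • (n : E3)) - g n * ∑ a ∈ T, r ^ a * c a n‖
      ≤ |M| * (ε / (2 * K)) := by
    intro n
    have h1 := hexp r hr hrδ n
    rw [finsum_eq_sum_T (T := T) (by simpa using hT0) ?_] at h1
    · simp only [Nat.cast_zero, Real.rpow_zero, mul_one] at h1
      rw [← mul_sub, norm_mul]
      exact mul_le_mul ((hM n).trans (le_abs_self M)) h1 (norm_nonneg _) (abs_nonneg _)
    · intro a ha hne
      refine hT a (by simpa using ha) fun h0 => hne ?_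
      simp [h0]
  have := norm_integral_le_of_norm_le_const (μ := dOmega) (Eventually.of_forall hb)
  rw [Real.norm_eq_abs] at this
  refine this.trans_lt ?_
  rw [measureReal_def]
  have h3 : |M| * (ε / (2 * K)) * (dOmega Set.univ).toReal = (ε / (2 * K)) * (K - 1) := by
    rw [hK]; ring
  rw [h3]
  have : (ε / (2 * K)) * (K - 1) < (ε / (2 * K)) * K :=
    mul_lt_mul_of_pos_left (by linarith) (by positivity)
  have h4 : (ε / (2 * K)) * K = ε / 2 := by field_simp
  linarith

lemma HasSingExpansion.finset {y : E3} {F : E3 → ℝ} {c : ℝ → S2 → ℝ}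
    (h : HasSingExpansion y F c) : ∃ T : Finset ℝ, (∀ a ∈ T, a ≤ 0) ∧
      ∀ a, a ≤ 0 → c a ≠ 0 → a ∈ T := by
  refine ⟨(h.finite_exponents 0).toFinset, fun a ha => ?_, fun a ha hc => ?_⟩
  · simp at ha; exact ha.1
  · simp [ha, hc]

lemma HasSingExpansion.add_congr {y : E3} {F G H : E3 → ℝ} {c d : ℝ → S2 → ℝ}
    (h : HasSingExpansion y F c) (h' : HasSingExpansion y G d) {ρ : ℝ} (hρ : 0 < ρ)
    (hH : ∀ x ∈ Metric.ball y ρ \ {y}, H x = F x + G x) :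
    HasSingExpansion y H (fun a n => c a n + d a n) where
  smooth_coeffs a := by
    obtain ⟨g, hg, e⟩ := h.smooth_coeffs a
    obtain ⟨g', hg', e'⟩ := h'.smooth_coeffs a
    exact ⟨fun x => g x + g' x, hg.add hg', fun n => by simp [e, e']⟩
  bddBelow := by
    obtain ⟨a, ha⟩ := h.bddBelow
    obtain ⟨b, hb⟩ := h'.bddBelow
    refine ⟨min a b, fun x hx => ?_⟩
    funext n
    simp [ha x (hx.trans_le (min_le_left _ _)), hb x (hx.trans_le (min_le_right _ _))]
  finite_exponents N := by
    refine ((h.finite_exponents N).union (h'.finite_exponents N)).subset ?_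
    rintro a ⟨ha, hne⟩
    by_cases hc : c a = 0
    · right
      refine ⟨ha, fun hd => hne ?_⟩
      funext n; simp [hc, hd]
    · exact Or.inl ⟨ha, hc⟩
  expansion N ε hε := by
    obtain ⟨δ, hδ, he⟩ := h.expansion N (ε / 2) (by positivity)
    obtain ⟨δ', hδ', he'⟩ := h'.expansion N (ε / 2) (by positivity)
    refine ⟨min (min δ δ') ρ, by positivity, fun r hr hrd n => ?_⟩
    have hn : ‖(n : E3)‖ = 1 := by simpa using n.2
    have h1 := he r hr (hrd.trans_le ((min_le_left _ _).trans (min_le_left _ _))) n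
    have h2 := he' r hr (hrd.trans_le ((min_le_left _ _).trans (min_le_right _ _))) n
    rw [hH (y + r • (n : E3)) ?_]
    · have : ∑ᶠ (a : ℝ) (_ : a ≤ (N : ℝ)), r ^ a * (c a n + d a n)
          = ∑ᶠ (a : ℝ) (_ : a ≤ (N : ℝ)), r ^ a * c a n
            + ∑ᶠ (a : ℝ) (_ : a ≤ (N : ℝ)), r ^ a * d a n := by
        set T := ((h.finite_exponents N).union (h'.finite_exponents N)).toFinset with hTdef
        have hTP : ∀ a ∈ T, a ≤ (N : ℝ) := by
          intro a ha
          simp [hTdef] at ha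
          rcases ha with ha | ha <;> exact ha.1
        have hc : ∀ a, a ≤ (N : ℝ) → r ^ a * c a n ≠ 0 → a ∈ T := by
          intro a ha hne
          simp only [hTdef, Set.Finite.mem_toFinset]
          exact Or.inl ⟨ha, fun h0 => hne (by simp [h0])⟩
        have hd : ∀ a, a ≤ (N : ℝ) → r ^ a * d a n ≠ 0 → a ∈ T := by
          intro a ha hne
          simp only [hTdef, Set.Finite.mem_toFinset]
          exact Or.inr ⟨ha, fun h0 => hne (by simp [h0])⟩
        rw [finsum_eq_sum_T hTP hc, finsum_eq_sum_T hTP hd, finsum_eq_sum_T hTP,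
          ← Finset.sum_add_distrib]
        · simp [mul_add]
        · intro a ha hne
          by_cases h0 : r ^ a * c a n = 0
          · refine hd a ha fun h1 => hne ?_
            rw [mul_add, h0, h1, add_zero]
          · exact hc a ha h0
      rw [this]
      have e3 : ∀ p q s t : ℝ, p + q - (s + t) = (p - s) + (q - t) := by intros; ring
      rw [e3]
      refine (abs_add_le _ _).trans ?_
      linarith
    · refine ⟨?_, ?_⟩
      · rw [Metric.mem_ball, dist_eq_norm]
        simp [norm_smul, abs_of_pos hr, hn, hrd.trans_le (min_le_right _ _)]
      · intro h0
        have h0 : y + r • (n : E3) = y := h0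
        rw [add_eq_left] at h0
        have := congrArg norm h0
        simp [norm_smul, hn, hr.ne'] at this

lemma sing_unique (c : ℝ → ℝ) (k L : ℝ) (T : Finset ℝ) : (∀ a ∈ T, a < 0) →
    Tendsto (fun s : ℝ => ∑ a ∈ T, c a * s ^ a + k * Real.log s) (𝓝[>] (0 : ℝ)) (𝓝 L) →
    (∀ a ∈ T, c a = 0) ∧ k = 0 := by
  induction T using Finset.induction_on_min with
  | empty =>
    intro _ h
    refine ⟨by simp, ?_⟩
    by_contra hk
    simp only [Finset.sum_empty, zero_add] at h
    have h2 := h.const_mul k⁻¹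
    have h3 : Tendsto Real.log (𝓝[>] (0 : ℝ)) (𝓝 (k⁻¹ * L)) := by
      refine h2.congr fun s => ?_
      field_simp
    exact not_tendsto_nhds_of_tendsto_atBot Real.tendsto_log_nhdsGT_zero _ h3
  | insert a T haT ih =>
    intro hneg h
    have ha : a < 0 := hneg a (Finset.mem_insert_self _ _)
    have hnot : a ∉ T := fun hh => lt_irrefl _ (haT a hh)
    have hpow : ∀ p : ℝ, 0 < p → Tendsto (fun s : ℝ => s ^ p) (𝓝[>] (0 : ℝ)) (𝓝 0) := by
      intro p hp
      have := (Real.continuousAt_rpow_const 0 p (Or.inr hp.le)).tendsto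
      rw [Real.zero_rpow hp.ne'] at this
      exact this.mono_left nhdsWithin_le_nhds
    have h0 := (hpow (-a) (by linarith)).mul h
    rw [zero_mul] at h0
    have h1 : Tendsto (fun s : ℝ => c a + ∑ b ∈ T, c b * s ^ (b - a)
        + k * (Real.log s * s ^ (-a))) (𝓝[>] (0 : ℝ)) (𝓝 (c a + ∑ b ∈ T, c b * 0 + k * 0)) := by
      refine (tendsto_const_nhds.add (tendsto_finsetSum _ fun b hb => ?_)).add ?_
      · exact (hpow (b - a) (by linarith [haT b hb])).const_mul _
      · exact (tendsto_log_mul_rpow_nhdsGT_zero (by linarith)).const_mul _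
    have h2 : Tendsto (fun s : ℝ => c a + ∑ b ∈ T, c b * s ^ (b - a)
        + k * (Real.log s * s ^ (-a))) (𝓝[>] (0 : ℝ)) (𝓝 0) := by
      refine h0.congr' ?_
      filter_upwards [self_mem_nhdsWithin] with s hs
      have hs : 0 < s := hs
      rw [Finset.sum_insert hnot, mul_add, mul_add, Finset.mul_sum]
      congr 1
      · congr 1
        · rw [mul_left_comm, ← Real.rpow_add hs]; simp
        · refine Finset.sum_congr rfl fun b _ => ?_
          rw [mul_left_comm, ← Real.rpow_add hs]; ring_nf
      · ring
    have hca : c a = 0 := by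
      have := tendsto_nhds_unique h1 h2
      simpa using this
    have h3 := ih (fun b hb => hneg b (Finset.mem_insert_of_mem hb)) (by
      simpa [Finset.sum_insert hnot, hca] using h)
    refine ⟨fun b hb => ?_, h3.2⟩
    rcases Finset.mem_insert.1 hb with rfl | hb
    · exact hca
    · exact h3.1 b hb

lemma shift_sum {T T' : Finset ℝ} {k : ℝ} {f : ℝ → ℝ} (h1 : ∀ a ∈ T, a + k < 0 → a + k ∈ T')
    (h2 : ∀ α ∈ T', α < 0) (h3 : ∀ α ∈ T', f α ≠ 0 → α - k ∈ T) :
    ∑ a ∈ T with a + k < 0, f (a + k) = ∑ α ∈ T', f α := by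
  rw [← Finset.sum_image (s := T.filter fun a => a + k < 0) (g := fun a => a + k) (f := f)
    (fun a _ b _ h => by simpa using h)]
  refine Finset.sum_subset ?_ ?_
  · intro α hα
    obtain ⟨a, ha, rfl⟩ := Finset.mem_image.1 hα
    rw [Finset.mem_filter] at ha
    exact h1 a ha.1 ha.2
  · intro α hα hn
    by_contra hf
    refine hn (Finset.mem_image.2 ⟨α - k, ?_, by ring⟩)
    rw [Finset.mem_filter]
    exact ⟨h3 α hα hf, by simpa using h2 α hα⟩

lemma tendsto_rpow_pos {p : ℝ} (hp : 0 < p) :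
    Tendsto (fun s : ℝ => s ^ p) (𝓝[>] (0 : ℝ)) (𝓝 0) := by
  have := (Real.continuousAt_rpow_const 0 p (Or.inr hp.le)).tendsto
  rw [Real.zero_rpow hp.ne'] at this
  exact this.mono_left nhdsWithin_le_nhds

/-- integrals of powers have an asymptotic expansion -/
lemma pow_int_tendsto (a t : ℝ) (ht : 0 < t) : ∃ C : ℝ, Tendsto (fun s : ℝ =>
    (∫ r in s..t, r ^ (a + 2)) + (if a + 3 < 0 then s ^ (a + 3) / (a + 3) else 0)
      + (if a = -3 then Real.log s else 0)) (𝓝[>] (0 : ℝ)) (𝓝 C) := by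
  have hmem : ∀ᶠ s : ℝ in 𝓝[>] (0 : ℝ), 0 < s := self_mem_nhdsWithin
  rcases lt_trichotomy (a + 3) 0 with h | h | h
  · refine ⟨t ^ (a + 3) / (a + 3), tendsto_const_nhds.congr' ?_⟩
    filter_upwards [hmem] with s hs
    have h3 : a ≠ -3 := by intro h'; linarith
    rw [integral_rpow (Or.inr ⟨by intro h'; apply h3; linarith, Set.notMem_uIcc_of_lt hs ht⟩)]
    rw [if_pos h, if_neg h3]
    have : a + 2 + 1 = a + 3 := by ring
    rw [this]; ring
  · refine ⟨Real.log t, tendsto_const_nhds.congr' ?_⟩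
    filter_upwards [hmem] with s hs
    have h3 : a = -3 := by linarith
    subst h3
    have : ∫ r in s..t, r ^ ((-3 : ℝ) + 2) = ∫ r in s..t, r⁻¹ := by
      have e : (-3 : ℝ) + 2 = -1 := by norm_num
      rw [e]
      refine intervalIntegral.integral_congr fun r hr => ?_
      have hr0 : 0 < r := (lt_min hs ht).trans_le hr.1
      simp only [Real.rpow_neg_one]
    rw [this, integral_inv_of_pos hs ht, Real.log_div ht.ne' hs.ne']
    norm_num
  · refine ⟨(t ^ (a + 3) - 0) / (a + 3), ?_⟩
    have h3 : a ≠ -3 := by intro h'; linarith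
    have := (tendsto_const_nhds (x := t ^ (a + 3))).sub (tendsto_rpow_pos h) |>.div_const (a + 3)
    refine this.congr' ?_
    filter_upwards [hmem] with s hs
    rw [integral_rpow (Or.inl (by linarith)), if_neg (by linarith), if_neg h3]
    have : a + 2 + 1 = a + 3 := by ring
    rw [this]; ring

lemma point_lemma (i : Fin 3) {y : E3} {H : E3 → ℝ} {p w : ℝ → S2 → ℝ} {ρ : ℝ} (hρ : 0 < ρ)
    (hH : ContDiffOn ℝ 1 H (Metric.ball y ρ \ {y}))
    (hp : HasSingExpansion y H p) (hw : HasSingExpansion y (pder i H) w) (s₁ : ℝ) :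
    Tendsto (fun s : ℝ => (∑ᶠ (a : ℝ) (_ : a < -3), s ^ (a + 3) / (a + 3) * ∫ n : S2, w a n ∂dOmega)
      + Real.log (s / s₁) * (∫ n : S2, w (-3) n ∂dOmega) - fluxI i y H s) (𝓝[>] (0 : ℝ))
      (𝓝 (- ∫ n : S2, (n : E3) i * p (-2) n ∂dOmega)) := by
  have hmem : ∀ᶠ s : ℝ in 𝓝[>] (0 : ℝ), 0 < s := self_mem_nhdsWithin
  have hopen : IsOpen (Metric.ball y ρ \ {y}) := Metric.isOpen_ball.sdiff isClosed_singleton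
  obtain ⟨Tp, hTp0, hTp⟩ := hp.finset
  obtain ⟨Tw, hTw0, hTw⟩ := hw.finset
  set T : Finset ℝ := Tp ∪ Tw ∪ {-2, -3} with hTdef
  have hT0 : ∀ a ∈ T, a ≤ 0 := by
    intro a ha
    simp only [hTdef, Finset.mem_union, Finset.mem_insert, Finset.mem_singleton] at ha
    rcases ha with (ha | ha) | ha | ha
    · exact hTp0 a ha
    · exact hTw0 a ha
    · linarith
    · linarith
  have hTp' : ∀ a, a ≤ 0 → p a ≠ 0 → a ∈ T := fun a ha h => by
    simp [hTdef, hTp a ha h]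
  have hTw' : ∀ a, a ≤ 0 → w a ≠ 0 → a ∈ T := fun a ha h => by
    simp [hTdef, hTw a ha h]
  have hT2 : (-2 : ℝ) ∈ T := by simp [hTdef]
  have hT3 : (-3 : ℝ) ∈ T := by simp [hTdef]
  set P : ℝ → ℝ := fun a => ∫ n : S2, (n : E3) i * p a n ∂dOmega with hP
  set W : ℝ → ℝ := fun a => ∫ n : S2, w a n ∂dOmega with hW
  have hPz : ∀ a, a ≤ 0 → P a ≠ 0 → a ∈ T := fun a ha h =>
    hTp' a ha fun h0 => h (by simp [hP, h0])
  have hWz : ∀ a, a ≤ 0 → W a ≠ 0 → a ∈ T := fun a ha h =>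
    hTw' a ha fun h0 => h (by simp [hW, h0])
  -- first: expansion of the flux
  have hgc : Continuous fun n : S2 => (n : E3) i := by fun_prop
  have e1 := sing_int hρ hp (fun n : S2 => (n : E3) i) hgc hH.continuousOn T hT0 hTp'
  have hsq : Tendsto (fun s : ℝ => s ^ 2) (𝓝[>] (0 : ℝ)) (𝓝 0) := by
    have : Tendsto (fun s : ℝ => s ^ 2) (𝓝 (0 : ℝ)) (𝓝 (0 ^ 2)) := (continuous_pow 2).tendsto 0
    simpa using this.mono_left nhdsWithin_le_nhds
  have f1 : Tendsto (fun s : ℝ => fluxI i y H s - ∑ a ∈ T with a + 2 < 0, s ^ (a + 2) * P (a + 2 - 2))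
      (𝓝[>] (0 : ℝ)) (𝓝 (P (-2))) := by
    have g1 : Tendsto (fun s : ℝ => ∑ a ∈ T, (if a + 2 < 0 then 0 else s ^ (a + 2) * P a))
        (𝓝[>] (0 : ℝ)) (𝓝 (∑ a ∈ T, if a = -2 then P a else 0)) := by
      refine tendsto_finsetSum _ fun a _ => ?_
      rcases lt_trichotomy (a + 2) 0 with h | h | h
      · have : a ≠ -2 := by intro h'; linarith
        simp [h, this]
      · have h' : a = -2 := by linarith
        simp [h']
      · have : a ≠ -2 := by intro h'; linarith
        simp only [not_lt.2 h.le, if_false, this]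
        simpa using (tendsto_rpow_pos h).mul_const (P a)
    rw [Finset.sum_ite_eq' T (-2 : ℝ) P, if_pos hT2] at g1
    have g2 := g1.add (hsq.mul e1)
    simp only [mul_zero, add_zero] at g2
    refine g2.congr' ?_
    filter_upwards [hmem] with s hs
    have k1 : ∀ a : ℝ, s ^ 2 * (s ^ a * P a) = s ^ (a + 2) * P a := by
      intro a
      rw [Real.rpow_add hs, Real.rpow_two]; ring
    have k2 : ∑ a ∈ T, s ^ 2 * (s ^ a * P a) = ∑ a ∈ T, (if a + 2 < 0 then s ^ (a + 2) * P a else 0)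
        + ∑ a ∈ T, (if a + 2 < 0 then 0 else s ^ (a + 2) * P a) := by
      rw [← Finset.sum_add_distrib]
      refine Finset.sum_congr rfl fun a _ => ?_
      rw [k1]; split_ifs <;> simp
    have k3 : ∑ a ∈ T with a + 2 < 0, s ^ (a + 2) * P (a + 2 - 2)
        = ∑ a ∈ T, (if a + 2 < 0 then s ^ (a + 2) * P a else 0) := by
      rw [Finset.sum_filter]
      simp
    rw [k3, mul_sub, Finset.mul_sum, k2]
    simp only [fluxI]
    ring
  -- second: through the radial integral
  have hwc : ContinuousOn (pder i H) (Metric.ball y ρ \ {y}) := continuousOn_pder i hopen hH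
  have e2 := sing_int hρ hw (fun _ : S2 => (1 : ℝ)) continuous_const hwc T hT0 hTw'
  have jc := continuousOn_sphInt y hwc (fun _ : S2 => (1 : ℝ)) continuous_const
  simp only [one_mul] at e2 jc
  set J : ℝ → ℝ := fun r => ∫ n : S2, pder i H (y + r • (n : E3)) ∂dOmega with hJ
  change Tendsto (fun r => J r - ∑ a ∈ T, r ^ a * W a) _ _ at e2
  set h : ℝ → ℝ := fun r => r ^ 2 * (J r - ∑ a ∈ T, r ^ a * W a) with hh
  have hhc : ContinuousOn h (Set.Ioo 0 ρ) := by
    refine (continuous_pow 2).continuousOn.mul (jc.sub ?_)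
    refine continuousOn_finsetSum _ fun a _ => ContinuousOn.mul ?_ continuousOn_const
    exact continuousOn_id.rpow_const fun x hx => Or.inl hx.1.ne'
  obtain ⟨t, ht0, htρ, htb⟩ : ∃ t, 0 < t ∧ t < ρ ∧ ∀ r ∈ Set.Ioc 0 t, ‖h r‖ ≤ 1 := by
    have e3 := hsq.mul e2
    rw [zero_mul] at e3
    have := e3.norm
    rw [norm_zero] at this
    have := this.eventually_lt_const (zero_lt_one)
    rw [eventually_nhdsWithin_iff, Metric.eventually_nhds_iff] at this
    obtain ⟨δ, hδ, hb⟩ := this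
    refine ⟨min (δ / 2) (ρ / 2), by positivity, ?_, ?_⟩
    · exact (min_le_right _ _).trans_lt (by linarith)
    · intro r hr
      have : r ≤ δ / 2 := hr.2.trans (min_le_left _ _)
      refine (hb (y := r) ?_ hr.1).le
      rw [Real.dist_eq, sub_zero, abs_of_pos hr.1]; linarith
  have hint : IntegrableOn h (Set.uIcc 0 t) := by
    rw [Set.uIcc_of_le ht0.le, integrableOn_Icc_iff_integrableOn_Ioc]
    refine IntegrableOn.of_bound (by simp) ?_ 1 ?_
    · exact hhc.mono (fun r hr => ⟨hr.1, hr.2.trans_lt htρ⟩) |>.aestronglyMeasurable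
        measurableSet_Ioc
    · exact (ae_restrict_iff' measurableSet_Ioc).2 (Eventually.of_forall htb)
  have hB : ∃ C, Tendsto (fun s => ∫ r in s..t, h r) (𝓝[>] (0 : ℝ)) (𝓝 C) := by
    refine ⟨∫ r in (0:ℝ)..t, h r, ?_⟩
    have := intervalIntegral.continuousOn_primitive_interval_left hint 0 Set.left_mem_uIcc
    rw [Set.uIcc_of_le ht0.le] at this
    exact (this.mono_of_mem_nhdsWithin (Icc_mem_nhdsGT ht0)).tendsto
  obtain ⟨CB, hB⟩ := hB
  choose C hC using fun a => pow_int_tendsto a t ht0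
  have f2 : Tendsto (fun s : ℝ => ∑ a ∈ T with a + 3 < 0, s ^ (a + 3) / (a + 3) * W (a + 3 - 3)
      + W (-3) * Real.log s - fluxI i y H s) (𝓝[>] (0 : ℝ))
      (𝓝 (∑ a ∈ T, C a * W a + CB - fluxI i y H t)) := by
    have g1 := ((tendsto_finsetSum T fun a _ => (hC a).mul_const (W a)).add hB).sub_const
      (fluxI i y H t)
    refine g1.congr' ?_
    filter_upwards [Ioc_mem_nhdsGT ht0] with s hs
    have hann := annulus i hH hs.1 hs.2 htρ
    have hsub : Set.uIcc s t ⊆ Set.Ioo 0 ρ := by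
      rw [Set.uIcc_of_le hs.2]
      exact fun r hr => ⟨hs.1.trans_le hr.1, hr.2.trans_lt htρ⟩
    have ipow : ∀ a : ℝ, IntervalIntegrable (fun r : ℝ => r ^ (a + 2)) volume s t := fun a =>
      intervalIntegral.intervalIntegrable_rpow (Or.inr (Set.notMem_uIcc_of_lt hs.1 ht0))
    have ih : IntervalIntegrable h volume s t := (hhc.mono hsub).intervalIntegrable
    have k1 : ∫ r in s..t, r ^ 2 * J r
        = ∑ a ∈ T, (∫ r in s..t, r ^ (a + 2)) * W a + ∫ r in s..t, h r := by
      simp_rw [← intervalIntegral.integral_mul_const]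
      rw [← intervalIntegral.integral_finsetSum fun a _ => (ipow a).mul_const (W a)]
      rw [← intervalIntegral.integral_add _ ih]
      · refine intervalIntegral.integral_congr fun r hr => ?_
        have hr0 := (hsub hr).1
        have : ∑ a ∈ T, r ^ (a + 2) * W a = r ^ 2 * ∑ a ∈ T, r ^ a * W a := by
          rw [Finset.mul_sum]
          refine Finset.sum_congr rfl fun a _ => ?_
          rw [Real.rpow_add hr0, Real.rpow_two]; ring
        simp only [hh, this]; ring
      · refine ContinuousOn.intervalIntegrable ?_
        refine continuousOn_finsetSum _ fun a _ => ContinuousOn.mul ?_ continuousOn_const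
        exact continuousOn_id.rpow_const fun x hx => Or.inl (hsub hx).1.ne'
    have k2 : ∑ a ∈ T with a + 3 < 0, s ^ (a + 3) / (a + 3) * W (a + 3 - 3)
        = ∑ a ∈ T, (if a + 3 < 0 then s ^ (a + 3) / (a + 3) else 0) * W a := by
      rw [Finset.sum_filter]
      refine Finset.sum_congr rfl fun a _ => ?_
      split_ifs <;> simp
    have k3 : W (-3) * Real.log s = ∑ a ∈ T, (if a = -3 then Real.log s else 0) * W a := by
      simp only [ite_mul, zero_mul]
      rw [Finset.sum_ite_eq' T (-3 : ℝ) (fun a => Real.log s * W a), if_pos hT3, mul_comm]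
    rw [k2, k3]
    simp only [add_mul, Finset.sum_add_distrib]
    change _ = ∫ r in s..t, r ^ 2 * J r at hann
    rw [k1] at hann
    linarith
  -- the comparison
  set T' : Finset ℝ := (T.filter fun a => a + 2 < 0).image (fun a => a + 2)
    ∪ (T.filter fun a => a + 3 < 0).image (fun a => a + 3) with hT'
  have hT'neg : ∀ α ∈ T', α < 0 := by
    intro α hα
    simp only [hT', Finset.mem_union, Finset.mem_image, Finset.mem_filter] at hα
    rcases hα with ⟨a, ha, rfl⟩ | ⟨a, ha, rfl⟩ <;> exact ha.2
  have sh2 : ∀ s : ℝ, ∑ a ∈ T with a + 2 < 0, s ^ (a + 2) * P (a + 2 - 2)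
      = ∑ α ∈ T', s ^ α * P (α - 2) := by
    intro s
    refine shift_sum (f := fun α => s ^ α * P (α - 2)) (fun a ha hn => ?_) hT'neg fun α hα hf => ?_
    · exact Finset.mem_union_left _ (Finset.mem_image.2 ⟨a, Finset.mem_filter.2 ⟨ha, hn⟩, rfl⟩)
    · exact hPz _ (by linarith [hT'neg α hα]) (right_ne_zero_of_mul hf)
  have sh3 : ∀ s : ℝ, ∑ a ∈ T with a + 3 < 0, s ^ (a + 3) / (a + 3) * W (a + 3 - 3)
      = ∑ α ∈ T', s ^ α / α * W (α - 3) := by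
    intro s
    refine shift_sum (f := fun α => s ^ α / α * W (α - 3)) (fun a ha hn => ?_) hT'neg
      fun α hα hf => ?_
    · exact Finset.mem_union_right _ (Finset.mem_image.2 ⟨a, Finset.mem_filter.2 ⟨ha, hn⟩, rfl⟩)
    · exact hWz _ (by linarith [hT'neg α hα]) (right_ne_zero_of_mul hf)
  simp only [sh2] at f1
  simp only [sh3] at f2
  have huniq := sing_unique (fun α => W (α - 3) / α - P (α - 2)) (W (-3)) _ T' hT'neg (by
    refine (f2.add f1).congr fun s => ?_
    have : ∑ α ∈ T', (W (α - 3) / α - P (α - 2)) * s ^ α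
        = ∑ α ∈ T', s ^ α / α * W (α - 3) - ∑ α ∈ T', s ^ α * P (α - 2) := by
      rw [← Finset.sum_sub_distrib]
      refine Finset.sum_congr rfl fun α _ => ?_
      ring
    rw [this]; ring)
  obtain ⟨hu1, hu2⟩ := huniq
  refine f1.neg.congr fun s => ?_
  have hfin : ∑ᶠ (a : ℝ) (_ : a < -3), s ^ (a + 3) / (a + 3) * W a
      = ∑ a ∈ T with a + 3 < 0, s ^ (a + 3) / (a + 3) * W a := by
    refine finsum_eq_sum_T (P := fun a => a < -3) (fun a ha => ?_) fun a ha hne => ?_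
    · linarith [(Finset.mem_filter.1 ha).2]
    · exact Finset.mem_filter.2 ⟨hWz a (by linarith) (right_ne_zero_of_mul hne), by linarith⟩
  have hfin2 : ∑ a ∈ T with a + 3 < 0, s ^ (a + 3) / (a + 3) * W a
      = ∑ α ∈ T', s ^ α * P (α - 2) := by
    have := sh3 s
    simp only [add_sub_cancel_right] at this
    rw [this]
    refine Finset.sum_congr rfl fun α hα => ?_
    have h0 : W (α - 3) / α - P (α - 2) = 0 := hu1 α hα
    rw [← sub_eq_zero.1 h0]; ring
  change _ = ∑ᶠ (a : ℝ) (_ : a < -3), s ^ (a + 3) / (a + 3) * W a + Real.log (s / s₁) * W (-3) - _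
  rw [hfin, hfin2, hu2]; ring

lemma integrableOn_outside {f : E3 → ℝ} {y₁ y₂ : E3} (hf : ContinuousOn f ({y₁, y₂}ᶜ : Set E3))
    (hi : ∃ R : ℝ, IntegrableOn f (Metric.closedBall 0 R)ᶜ volume) {s : ℝ} (hs : 0 < s) :
    IntegrableOn f (Metric.closedBall y₁ s ∪ Metric.closedBall y₂ s)ᶜ := by
  obtain ⟨R, hR⟩ := hi
  have hK : IsCompact (Metric.closedBall (0 : E3) R \ (Metric.ball y₁ s ∪ Metric.ball y₂ s)) :=
    (isCompact_closedBall _ _).diff (Metric.isOpen_ball.union Metric.isOpen_ball)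
  have h2 : IntegrableOn f (Metric.closedBall (0 : E3) R \ (Metric.ball y₁ s ∪ Metric.ball y₂ s)) := by
    refine (hf.mono ?_).integrableOn_compact hK
    rintro x ⟨_, hx⟩ h
    refine hx ?_
    rcases h with h | h
    · left; rw [h]; exact Metric.mem_ball_self hs
    · right; rw [h]; exact Metric.mem_ball_self hs
  refine (hR.union h2).mono_set ?_
  intro x hx
  by_cases hxR : x ∈ Metric.closedBall (0 : E3) R
  · refine Or.inr ⟨hxR, fun h => hx ?_⟩
    exact Set.union_subset_union Metric.ball_subset_closedBall Metric.ball_subset_closedBall h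
  · exact Or.inl hxR

lemma finsum_coef_add {y : E3} {F G : E3 → ℝ} {c d : ℝ → S2 → ℝ}
    (h : HasSingExpansion y F c) (h' : HasSingExpansion y G d) (k : ℝ → ℝ) :
    ∑ᶠ (a : ℝ) (_ : a < -3), k a * ∫ n : S2, (c a n + d a n) ∂dOmega
      = ∑ᶠ (a : ℝ) (_ : a < -3), k a * ∫ n : S2, c a n ∂dOmega
        + ∑ᶠ (a : ℝ) (_ : a < -3), k a * ∫ n : S2, d a n ∂dOmega := by
  have hadd : ∀ a, ∫ n : S2, (c a n + d a n) ∂dOmega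
      = ∫ n : S2, c a n ∂dOmega + ∫ n : S2, d a n ∂dOmega := fun a =>
    integral_add (integrable_sph (h.smooth_coeffs a).cont)
      (integrable_sph (h'.smooth_coeffs a).cont)
  obtain ⟨T, hT0, hT⟩ := h.finset
  obtain ⟨T', hT0', hT'⟩ := h'.finset
  set S := (T ∪ T').filter fun a => a < -3 with hS
  have hSP : ∀ a ∈ S, a < -3 := fun a ha => (Finset.mem_filter.1 ha).2
  have hc : ∀ a, a < -3 → k a * ∫ n : S2, c a n ∂dOmega ≠ 0 → a ∈ S := by
    intro a ha hne
    refine Finset.mem_filter.2 ⟨Finset.mem_union_left _ (hT a (by linarith) fun h0 => hne ?_), ha⟩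
    simp [h0]
  have hd : ∀ a, a < -3 → k a * ∫ n : S2, d a n ∂dOmega ≠ 0 → a ∈ S := by
    intro a ha hne
    refine Finset.mem_filter.2 ⟨Finset.mem_union_right _ (hT' a (by linarith) fun h0 => hne ?_), ha⟩
    simp [h0]
  rw [finsum_eq_sum_T (P := fun a => a < -3) hSP hc, finsum_eq_sum_T (P := fun a => a < -3) hSP hd,
    finsum_eq_sum_T (P := fun a => a < -3) hSP, ← Finset.sum_add_distrib]
  · simp [hadd, mul_add]
  · intro a ha hne
    by_cases h0 : k a * ∫ n : S2, c a n ∂dOmega = 0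
    · refine hd a ha fun h1 => hne ?_
      rw [hadd, mul_add, h0, h1, add_zero]
    · exact hc a ha h0

/-- rule of integration by parts for partie-finie integrals:
`Pf ∫ F∂_iG = −Pf ∫ G∂_iF − 4π(n₁ⁱr₁²FG)₁ − 4π(n₂ⁱr₂²FG)₂`, where
`(n₁ⁱr₁²FG)₁ = (1/4π) ∫ nⁱ (coefficient of r₁⁻² of FG) dΩ`, etc. -/
theorem pf_integration_by_parts
    (y₁ y₂ : E3) (hy : y₁ ≠ y₂) (s₁ s₂ : ℝ) (hs₁ : 0 < s₁) (hs₂ : 0 < s₂)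
    (F G : E3 → ℝ) (cF dF cG dG : ℝ → S2 → ℝ)
    (hF : MemF y₁ y₂ F cF dF) (hG : MemF y₁ y₂ G cG dG)
    (hciF : IntegerExponents cF) (hdiF : IntegerExponents dF)
    (hciG : IntegerExponents cG) (hdiG : IntegerExponents dG)
    (i : Fin 3)
    -- the gradients ∂_iF and ∂_iG admit singular expansions at both points
    (hdF₁ : ∃ e, HasSingExpansion y₁ (pder i F) e)
    (hdF₂ : ∃ e, HasSingExpansion y₂ (pder i F) e)
    (hdG₁ : ∃ e, HasSingExpansion y₁ (pder i G) e)
    (hdG₂ : ∃ e, HasSingExpansion y₂ (pder i G) e)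
    -- expansions of the product FG at the two singular points
    (p₁ p₂ : ℝ → S2 → ℝ)
    (hp₁ : HasSingExpansion y₁ (fun x => F x * G x) p₁)
    (hp₂ : HasSingExpansion y₂ (fun x => F x * G x) p₂)
    -- decay at infinity: FG = o(|x|⁻²), and F∂_iG, G∂_iF integrable near infinity
    (hdecay : Tendsto (fun x : E3 => ‖x‖ ^ 2 * (F x * G x)) (cocompact E3) (𝓝 0))
    (hint₁ : ∃ R : ℝ, IntegrableOn (fun x => F x * pder i G x) (Metric.closedBall 0 R)ᶜ volume)
    (hint₂ : ∃ R : ℝ, IntegrableOn (fun x => G x * pder i F x) (Metric.closedBall 0 R)ᶜ volume)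
    -- expansions of G∂_iF and the existence of Pf ∫ G∂_iF = A
    (u₁ u₂ : ℝ → S2 → ℝ)
    (hu₁ : HasSingExpansion y₁ (fun x => G x * pder i F x) u₁)
    (hu₂ : HasSingExpansion y₂ (fun x => G x * pder i F x) u₂)
    (A : ℝ)
    (hA : HasPfIntegral y₁ y₂ s₁ s₂ (fun x => G x * pder i F x) u₁ u₂ A)
    -- expansions of F∂_iG
    (v₁ v₂ : ℝ → S2 → ℝ)
    (hv₁ : HasSingExpansion y₁ (fun x => F x * pder i G x) v₁)
    (hv₂ : HasSingExpansion y₂ (fun x => F x * pder i G x) v₂) :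
    HasPfIntegral y₁ y₂ s₁ s₂ (fun x => F x * pder i G x) v₁ v₂
      (-A - (∫ n : S2, (n : E3) i * p₁ (-2) n ∂dOmega)
          - ∫ n : S2, (n : E3) i * p₂ (-2) n ∂dOmega) := by
  have hopen : IsOpen ({y₁, y₂}ᶜ : Set E3) := (Set.toFinite _).isClosed.isOpen_compl
  have hF1 : ContDiffOn ℝ 1 F ({y₁, y₂}ᶜ : Set E3) := hF.smooth.of_le (by exact_mod_cast le_top)
  have hG1 : ContDiffOn ℝ 1 G ({y₁, y₂}ᶜ : Set E3) := hG.smooth.of_le (by exact_mod_cast le_top)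
  have hH : ContDiffOn ℝ 1 (fun x => F x * G x) ({y₁, y₂}ᶜ : Set E3) := hF1.mul hG1
  have hcF := continuousOn_pder i hopen hF1
  have hcG := continuousOn_pder i hopen hG1
  have hprod : ∀ x ∈ ({y₁, y₂}ᶜ : Set E3), pder i (fun x => F x * G x) x
      = F x * pder i G x + G x * pder i F x := by
    intro x hx
    have d1 : DifferentiableAt ℝ F x :=
      (hF1.contDiffAt (hopen.mem_nhds hx)).differentiableAt (by simp)
    have d2 : DifferentiableAt ℝ G x :=
      (hG1.contDiffAt (hopen.mem_nhds hx)).differentiableAt (by simp)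
    unfold pder
    rw [fderiv_fun_mul d1 d2]
    simp
  have hD : 0 < dist y₁ y₂ := dist_pos.2 hy
  have sub₁ : Metric.ball y₁ (dist y₁ y₂) \ {y₁} ⊆ ({y₁, y₂}ᶜ : Set E3) := by
    rintro x ⟨hx, hx1⟩ (h | h)
    · exact hx1 h
    · have h : x = y₂ := h
      rw [h, Metric.mem_ball, dist_comm] at hx
      exact lt_irrefl _ hx
  have sub₂ : Metric.ball y₂ (dist y₁ y₂) \ {y₂} ⊆ ({y₁, y₂}ᶜ : Set E3) := by
    rintro x ⟨hx, hx1⟩ (h | h)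
    · have h : x = y₁ := h
      rw [h, Metric.mem_ball] at hx
      exact lt_irrefl _ hx
    · exact hx1 h
  have hw₁ : HasSingExpansion y₁ (pder i fun x => F x * G x) (fun a n => v₁ a n + u₁ a n) :=
    hv₁.add_congr hu₁ hD fun x hx => hprod x (sub₁ hx)
  have hw₂ : HasSingExpansion y₂ (pder i fun x => F x * G x) (fun a n => v₂ a n + u₂ a n) :=
    hv₂.add_congr hu₂ hD fun x hx => hprod x (sub₂ hx)
  have q₁ := point_lemma i hD (hH.mono sub₁) hp₁ hw₁ s₁
  have q₂ := point_lemma i hD (hH.mono sub₂) hp₂ hw₂ s₂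
  have hadd : ∀ {c d : S2 → ℝ}, SmoothSphereFn c → SmoothSphereFn d →
      ∫ n : S2, (c n + d n) ∂dOmega = ∫ n : S2, c n ∂dOmega + ∫ n : S2, d n ∂dOmega :=
    fun hc hd => integral_add (integrable_sph hc.cont) (integrable_sph hd.cont)
  unfold HasPfIntegral at hA ⊢
  have key := (q₁.add q₂).sub hA
  have elim : -A - (∫ n : S2, (n : E3) i * p₁ (-2) n ∂dOmega)
          - ∫ n : S2, (n : E3) i * p₂ (-2) n ∂dOmega
      = -(∫ n : S2, (n : E3) i * p₁ (-2) n ∂dOmega)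
        + -(∫ n : S2, (n : E3) i * p₂ (-2) n ∂dOmega) - A := by ring
  rw [elim]
  refine key.congr' ?_
  have hsmall : Set.Ioo (0 : ℝ) (dist y₁ y₂ / 6) ∈ 𝓝[>] (0 : ℝ) := Ioo_mem_nhdsGT (by positivity)
  filter_upwards [hsmall] with s hs
  have hs0 := hs.1
  have iv : IntegrableOn (fun x => F x * pder i G x)
      (Metric.closedBall y₁ s ∪ Metric.closedBall y₂ s)ᶜ :=
    integrableOn_outside (hF1.continuousOn.mul hcG) hint₁ hs0
  have iu : IntegrableOn (fun x => G x * pder i F x)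
      (Metric.closedBall y₁ s ∪ Metric.closedBall y₂ s)ᶜ :=
    integrableOn_outside (hG1.continuousOn.mul hcF) hint₂ hs0
  have hOm : MeasurableSet ((Metric.closedBall y₁ s ∪ Metric.closedBall y₂ s)ᶜ : Set E3) :=
    (Metric.isClosed_closedBall.union Metric.isClosed_closedBall).measurableSet.compl
  have hOsub : ∀ x ∈ ((Metric.closedBall y₁ s ∪ Metric.closedBall y₂ s)ᶜ : Set E3),
      pder i (fun x => F x * G x) x = F x * pder i G x + G x * pder i F x := by
    intro x hx
    refine hprod x fun h => hx ?_
    rcases h with h | h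
    · left; rw [h]; exact Metric.mem_closedBall_self hs0.le
    · right; rw [h]; exact Metric.mem_closedBall_self hs0.le
  have iw : IntegrableOn (pder i fun x => F x * G x)
      (Metric.closedBall y₁ s ∪ Metric.closedBall y₂ s)ᶜ :=
    (iv.add iu).congr_fun (fun x hx => (hOsub x hx).symm) hOm
  have hdiv := div_global i hH hs0 (by linarith [hs.2]) iw hdecay
  rw [setIntegral_congr_fun hOm hOsub, integral_add iv iu] at hdiv
  unfold pfApprox
  rw [finsum_coef_add hv₁ hu₁, finsum_coef_add hv₂ hu₂,
    hadd (hv₁.smooth_coeffs _) (hu₁.smooth_coeffs _),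
    hadd (hv₂.smooth_coeffs _) (hu₂.smooth_coeffs _)]
  linarith

end
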